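/- Let G_1 and G_2 be two chain graphs on the same finite vertex set V, and let A ⊆ V be a set of intervened variables fixed at x_A = a_0. If removing from G_1 all vertices of A together with all edges incident to vertices of A yields the same chain graph as performing the same removal in G_2, then G_1 and G_2 admit the same factorization decomposition: a pmf f on configurations consistent with x_A = a_0 factorizes according to (G_1, A) if and only if it factorizes according to (G_2, A). -/

import Mathlib

namespace BH

variable {V : Type*}

/-- The edge set of a directed hypergraph on vertex set `V`:
each hyperedge is an ordered pair `(tail, head)` of subsets of `V`. -/
abbrev HEdges (V : Type*) := Set (Set V × Set V)

/-- Every hyperedge has disjoint tail and head. -/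
def HDisjoint (E : HEdges V) : Prop := ∀ h ∈ E, Disjoint h.1 h.2

/-- `u` is a parent of `v` in the directed hypergraph. -/
def hPar (E : HEdges V) (u v : V) : Prop := ∃ h ∈ E, u ∈ h.1 ∧ v ∈ h.2

/-- `u` and `v` are neighbors (co-head) in the directed hypergraph. -/
def hNbr (E : HEdges V) (u v : V) : Prop := ∃ h ∈ E, u ∈ h.2 ∧ v ∈ h.2 ∧ u ≠ v

/-- A partially directed cycle with respect to a neighbor relation `nbr` and a
parent relation `par`: a cyclic sequence `v_1, …, v_k, v_{k+1} = v_1` in which every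
step is a neighbor-or-parent step and at least one step is a parent step. -/
def PDCycle (nbr par : V → V → Prop) : Prop :=
  ∃ (n : ℕ) (f : ZMod (n + 1) → V),
    (∀ i, nbr (f i) (f (i + 1)) ∨ par (f i) (f (i + 1))) ∧
    (∃ i, par (f i) (f (i + 1)))

/-- A directed hypergraph is acyclic if it has no partially directed cycle. -/
def HAcyclic (E : HEdges V) : Prop := ¬ PDCycle (hNbr E) (hPar E)

/-- Graph notions: a graph on `V` is a set of ordered pairs.
`u` is a parent of `v` if `(u,v)` is a directed edge. -/
def gPar (E : Set (V × V)) (u v : V) : Prop := (u, v) ∈ E ∧ (v, u) ∉ E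

/-- `u` and `v` are neighbors if `(u,v)` is an undirected edge. -/
def gNbr (E : Set (V × V)) (u v : V) : Prop := (u, v) ∈ E ∧ (v, u) ∈ E

/-- A chain graph is a graph with no partially directed cycle. -/
def IsChainGraph (E : Set (V × V)) : Prop := ¬ PDCycle (gNbr E) (gPar E)

/-- The shadow of a directed hypergraph: for every hyperedge `(X,Y)`, any two
distinct vertices of `Y` are joined by an undirected edge and there is a directed
edge from every vertex of `X` to every vertex of `Y`. -/
def shadow (E : HEdges V) : Set (V × V) :=
  {p | ∃ h ∈ E, (p.1 ∈ h.2 ∧ p.2 ∈ h.2 ∧ p.1 ≠ p.2) ∨ (p.1 ∈ h.1 ∧ p.2 ∈ h.2)}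

/-- Chain component of `v` in a directed hypergraph: reflexive-transitive closure
of the co-head relation. -/
def hComp (E : HEdges V) (v : V) : Set V := {u | Relation.ReflTransGen (hNbr E) v u}

/-- The set of chain components of a directed hypergraph. -/
def hComps (E : HEdges V) : Set (Set V) := {S | ∃ v, S = hComp E v}

/-- Chain component of `v` in a graph: vertices joined to `v` by undirected paths. -/
def gComp (E : Set (V × V)) (v : V) : Set V := {u | Relation.ReflTransGen (gNbr E) v u}

/-- The set of chain components of a graph. -/
def gComps (E : Set (V × V)) : Set (Set V) := {S | ∃ v, S = gComp E v}

/-- Parent set of a vertex in a hypergraph. -/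
def hPaSet (E : HEdges V) (v : V) : Set V := {u | hPar E u v}

/-- Neighbor set of a vertex in a hypergraph. -/
def hNbSet (E : HEdges V) (v : V) : Set V := {u | hNbr E u v}

/-- Parent set of a vertex in a graph. -/
def gPaSet (E : Set (V × V)) (v : V) : Set V := {u | gPar E u v}

/-- Neighbor set of a vertex in a graph. -/
def gNbSet (E : Set (V × V)) (v : V) : Set V := {u | gNbr E u v}

/-- `pa(τ)` for a vertex set `τ` in a graph. -/
def gPaTau (E : Set (V × V)) (τ : Set V) : Set V := (⋃ v ∈ τ, gPaSet E v) \ τ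

/-- `bd(τ)` for a vertex set `τ` in a graph. -/
def gBd (E : Set (V × V)) (τ : Set V) : Set V := (⋃ v ∈ τ, gPaSet E v ∪ gNbSet E v) \ τ

/-- `cl(τ) = bd(τ) ∪ τ`. -/
def gCl (E : Set (V × V)) (τ : Set V) : Set V := gBd E τ ∪ τ

/-- `pa(τ)` for a vertex set `τ` in a hypergraph. -/
def hPaTau (E : HEdges V) (τ : Set V) : Set V := (⋃ v ∈ τ, hPaSet E v) \ τ

/-- Induced subgraph on a vertex set. -/
def gInduced (E : Set (V × V)) (A : Set V) : Set (V × V) := {p ∈ E | p.1 ∈ A ∧ p.2 ∈ A}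

/-- Induced sub-hypergraph on a vertex set. -/
def hInduced (E : HEdges V) (A : Set V) : HEdges V := {h ∈ E | h.1 ∪ h.2 ⊆ A}

/-- Anterior set of `S` with respect to neighbor/parent relations: all vertices with
a neighbor-or-parent-step path to some vertex of `S` (including `S` itself). -/
def antOf (nbr par : V → V → Prop) (S : Set V) : Set V :=
  {w | ∃ s ∈ S, Relation.ReflTransGen (fun a b => nbr a b ∨ par a b) w s}

/-- Anterior set in a graph. -/
def gAnt (E : Set (V × V)) (S : Set V) : Set V := antOf (gNbr E) (gPar E) S

/-- Anterior set in a hypergraph. -/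
def hAnt (E : HEdges V) (S : Set V) : Set V := antOf (hNbr E) (hPar E) S

/-- The moral graph of a graph: its underlying undirected graph with all pairs of
distinct vertices inside `bd(τ)` joined, for every chain component `τ`. -/
def moral (E : Set (V × V)) : Set (V × V) :=
  {p | (p.1, p.2) ∈ E ∨ (p.2, p.1) ∈ E ∨
    ∃ τ ∈ gComps E, p.1 ∈ gBd E τ ∧ p.2 ∈ gBd E τ ∧ p.1 ≠ p.2}

/-- `K` is a clique with respect to the (symmetric) pair set `U`. -/
def IsCliqueIn (U : Set (V × V)) (K : Set V) : Prop :=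
  ∀ u ∈ K, ∀ v ∈ K, u ≠ v → (u, v) ∈ U

/-- `K` is a maximal clique of `U` inside the vertex set `S`. -/
def IsMaxCliqueWithin (U : Set (V × V)) (S K : Set V) : Prop :=
  K.Nonempty ∧ K ⊆ S ∧ IsCliqueIn U K ∧
    ∀ K', K ⊆ K' → K' ⊆ S → IsCliqueIn U K' → K' = K

/-- The maximal cliques of the pair set `U`. -/
def maxCliques (U : Set (V × V)) : Set (Set V) :=
  {K | IsMaxCliqueWithin U Set.univ K}

/-- The undirected part of a graph, as a set of pairs. -/
def uPart (E : Set (V × V)) : Set (V × V) := {p | gNbr E p.1 p.2}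

/-- The set of children of a vertex in a graph. -/
def children (E : Set (V × V)) (v : V) : Set V := {w | gPar E v w}

/-- Phase I, first stage of the canonical LWF DAH construction: for each vertex `v`
with children set `S_v`, the hyperedge `({v}, K)` for every maximal clique `K` of the
undirected part of `G[S_v]`. -/
def phase1a (E : Set (V × V)) : HEdges V :=
  {h | ∃ v K, IsMaxCliqueWithin (uPart E) (children E v) K ∧ h = ({v}, K)}

/-- Phase I of the canonical LWF DAH construction. -/
def phase1 (E : Set (V × V)) : HEdges V :=
  phase1a E ∪
    {h | ∃ K, IsMaxCliqueWithin (uPart E) Set.univ K ∧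
      (∀ h' ∈ phase1a E, ¬ K ⊆ h'.2) ∧ h = (∅, K)}

/-- The Phase-I hyperedges lying inside `cl(τ)` whose head meets `τ`. -/
def HstarI (E : Set (V × V)) (τ : Set V) : HEdges V :=
  {h ∈ phase1 E | h.1 ∪ h.2 ⊆ gCl E τ ∧ (h.2 ∩ τ).Nonempty}

/-- The canonical LWF DAH of a chain graph (its set of hyperedges): for every chain
component `τ` and every nonempty family `F ⊆ H*_τ` with `B = ⋂_{h ∈ F} H(h)`, the
hyperedge `(⋃ {T(h) : h ∈ H*_τ, B ⊆ H(h)}, B)`. -/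
def canonicalLWF (E : Set (V × V)) : HEdges V :=
  {e | ∃ τ ∈ gComps E, ∃ F, F ⊆ HstarI E τ ∧ F.Nonempty ∧
    e.2 = {x | ∀ g ∈ F, x ∈ g.2} ∧
    e.1 = {x | ∃ h ∈ HstarI E τ, e.2 ⊆ h.2 ∧ x ∈ h.1}}

/-- The hyperedges of `H[τ ∪ pa(τ)]` whose head is contained in `τ`. -/
def HstarF (E : HEdges V) (τ : Set V) : HEdges V :=
  {h ∈ hInduced E (τ ∪ hPaTau E τ) | h.2 ⊆ τ}

/-- The hyperedges of a family whose underlying vertex sets are maximal under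
set containment. -/
def maximalIn (E : HEdges V) : HEdges V :=
  {h ∈ E | ∀ h' ∈ E, h.1 ∪ h.2 ⊆ h'.1 ∪ h'.2 → h'.1 ∪ h'.2 = h.1 ∪ h.2}

/-- Descendants of `v` with respect to a parent relation. -/
def desc (par : V → V → Prop) (v : V) : Set V := {u | Relation.TransGen par v u}

/-- Non-descendants of `v`. -/
def ndOf (par : V → V → Prop) (v : V) : Set V := {u | u ∉ desc par v}

/-- Adjacency with respect to neighbor/parent relations. -/
def adjOf (nbr par : V → V → Prop) (u v : V) : Prop := par u v ∨ par v u ∨ nbr u v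

/-- Boundary of a vertex. -/
def bdOf (nbr par : V → V → Prop) (v : V) : Set V := {u | par u v} ∪ {u | nbr u v}

/-- Closure of a vertex. -/
def clOf (nbr par : V → V → Prop) (v : V) : Set V := bdOf nbr par v ∪ {v}

/-- `C` separates `A` and `B` in the undirected graph with pair set `U`:
every path from `A` to `B` meets `C`. -/
def Separates (U : Set (V × V)) (A B C : Set V) : Prop :=
  ∀ (n : ℕ) (f : Fin (n + 1) → V), f 0 ∈ A → f (Fin.last n) ∈ B →
    (∀ i : Fin n, (f i.castSucc, f i.succ) ∈ U) → ∃ i, f i ∈ C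

section Prob

variable [Fintype V] [DecidableEq V] {X : V → Type*} [∀ v, Fintype (X v)]

/-- `p` is a probability mass function. -/
def IsPMF (p : (∀ v, X v) → ℝ) : Prop := (∀ x, 0 ≤ p x) ∧ ∑ x, p x = 1

/-- Marginal of `p` on the coordinates in `S`, evaluated at `x`. -/
noncomputable def marginal (p : (∀ v, X v) → ℝ) (S : Set V) (x : ∀ v, X v) : ℝ :=
  ∑ y, Set.indicator {z : ∀ v, X v | ∀ v ∈ S, z v = x v} p y

/-- Conditional independence `A ⟂ B | C` for the pmf `p`. -/
def CI (p : (∀ v, X v) → ℝ) (A B C : Set V) : Prop :=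
  ∀ x, marginal p (A ∪ B ∪ C) x * marginal p C x
      = marginal p (A ∪ C) x * marginal p (B ∪ C) x

/-- The intersection property (S5). -/
def S5 (p : (∀ v, X v) → ℝ) : Prop :=
  ∀ A B C D : Set V, Disjoint A B → Disjoint A C → Disjoint A D →
    Disjoint B C → Disjoint B D → Disjoint C D →
    CI p A B (D ∪ C) → CI p A D (B ∪ C) → CI p A (B ∪ D) C

/-- Pairwise Markov property with respect to neighbor/parent relations. -/
def PairwiseMarkov (nbr par : V → V → Prop) (p : (∀ v, X v) → ℝ) : Prop :=
  ∀ v u, v ≠ u → ¬ adjOf nbr par v u → u ∈ ndOf par v →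
    CI p {v} {u} (ndOf par v \ {v, u})

/-- Local Markov property with respect to neighbor/parent relations. -/
def LocalMarkov (nbr par : V → V → Prop) (p : (∀ v, X v) → ℝ) : Prop :=
  ∀ v, CI p {v} (ndOf par v \ clOf nbr par v) (bdOf nbr par v)

/-- Global Markov property relative to a chain graph. -/
def GlobalMarkovG (E : Set (V × V)) (p : (∀ v, X v) → ℝ) : Prop :=
  ∀ A B C : Set V, Disjoint A B → Disjoint A C → Disjoint B C →
    Separates (moral (gInduced E (gAnt E (A ∪ B ∪ C)))) A B C → CI p A B C

/-- Global Markov property relative to a directed hypergraph. -/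
def GlobalMarkovH (E : HEdges V) (p : (∀ v, X v) → ℝ) : Prop :=
  ∀ A B C : Set V, Disjoint A B → Disjoint A C → Disjoint B C →
    Separates (moral (shadow (hInduced E (hAnt E (A ∪ B ∪ C))))) A B C → CI p A B C

/-- `f` depends only on the coordinates in `S`. -/
def DependsOn (f : (∀ v, X v) → ℝ) (S : Set V) : Prop :=
  ∀ x y, (∀ v ∈ S, x v = y v) → f x = f y

/-- Conditional pmf `p(x_S | x_T)` as a ratio of marginals. -/
noncomputable def condM (p : (∀ v, X v) → ℝ) (S T : Set V) (x : ∀ v, X v) : ℝ :=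
  marginal p (S ∪ T) x / marginal p T x

/-- Sum of `F` over the coordinates in `τ`, the remaining coordinates fixed at `x`. -/
noncomputable def sumOver (τ : Set V) (F : (∀ v, X v) → ℝ) (x : ∀ v, X v) : ℝ :=
  ∑ y, Set.indicator {z : ∀ v, X v | ∀ v, v ∉ τ → z v = x v} F y

/-- Factorization (CF) of a pmf according to a chain graph. -/
def FactorizesCG (E : Set (V × V)) (p : (∀ v, X v) → ℝ) : Prop :=
  (∀ x, p x = ∏ᶠ τ ∈ gComps E, condM p τ (gPaTau E τ) x) ∧
  ∀ τ ∈ gComps E, ∃ ψ : Set V → (∀ v, X v) → ℝ,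
    (∀ K ∈ maxCliques (moral (gInduced E (τ ∪ gPaTau E τ))),
      (∀ x, 0 ≤ ψ K x) ∧ DependsOn (ψ K) K) ∧
    ∀ x, condM p τ (gPaTau E τ) x
      = (∏ᶠ K ∈ maxCliques (moral (gInduced E (τ ∪ gPaTau E τ))), ψ K x) /
        sumOver τ (fun y => ∏ᶠ K ∈ maxCliques (moral (gInduced E (τ ∪ gPaTau E τ))), ψ K y) x

/-- Factorization (HF) of a pmf according to a directed acyclic hypergraph. -/
def FactorizesBH (E : HEdges V) (p : (∀ v, X v) → ℝ) : Prop :=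
  (∀ x, p x = ∏ᶠ τ ∈ hComps E, condM p τ (hPaTau E τ) x) ∧
  ∀ τ ∈ hComps E, ∃ ψ : Set V × Set V → (∀ v, X v) → ℝ,
    (∀ h ∈ maximalIn (HstarF E τ), (∀ x, 0 ≤ ψ h x) ∧ DependsOn (ψ h) (h.1 ∪ h.2)) ∧
    (∀ x, condM p τ (hPaTau E τ) x = ∏ᶠ h ∈ maximalIn (HstarF E τ), ψ h x) ∧
    (∀ x, sumOver τ (fun y => ∏ᶠ h ∈ maximalIn (HstarF E τ), ψ h y) x = 1)

/-- Factorization of a pmf according to a chain graph with intervened set `A`. -/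
def FactorizesCGInt (E : Set (V × V)) (A : Set V) (f : (∀ v, X v) → ℝ) : Prop :=
  (∀ x, f x = ∏ᶠ τ ∈ gComps E, condM f (τ \ A) (gPaTau E τ ∪ (τ ∩ A)) x) ∧
  ∀ τ ∈ gComps E, ∃ ψ : Set V → (∀ v, X v) → ℝ,
    (∀ K ∈ maxCliques (moral (gInduced E (τ ∪ gPaTau E τ))),
      (∀ x, 0 ≤ ψ K x) ∧ DependsOn (ψ K) K) ∧
    ∀ x, condM f (τ \ A) (gPaTau E τ ∪ (τ ∩ A)) x
      = (∏ᶠ K ∈ maxCliques (moral (gInduced E (τ ∪ gPaTau E τ))), ψ K x) /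
        sumOver (τ \ A)
          (fun y => ∏ᶠ K ∈ maxCliques (moral (gInduced E (τ ∪ gPaTau E τ))), ψ K y) x

/-- Factorization of a pmf according to a directed acyclic hypergraph with
intervened set `A`. -/
def FactorizesBHInt (E : HEdges V) (A : Set V) (f : (∀ v, X v) → ℝ) : Prop :=
  (∀ x, f x = ∏ᶠ τ ∈ hComps E, condM f (τ \ A) (hPaTau E τ ∪ (τ ∩ A)) x) ∧
  ∀ τ ∈ hComps E, ∃ ψ : Set V × Set V → (∀ v, X v) → ℝ,
    (∀ h ∈ maximalIn (HstarF E τ), (∀ x, 0 ≤ ψ h x) ∧ DependsOn (ψ h) (h.1 ∪ h.2)) ∧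
    ∀ x, condM f (τ \ A) (hPaTau E τ ∪ (τ ∩ A)) x
      = (∏ᶠ h ∈ maximalIn (HstarF E τ), ψ h x) /
        sumOver (τ \ A) (fun y => ∏ᶠ h ∈ maximalIn (HstarF E τ), ψ h y) x

/-- `f` is supported on configurations consistent with the intervention `x_A = a₀`. -/
def ConsistentWith (f : (∀ v, X v) → ℝ) (A : Set V) (a0 : ∀ v, X v) : Prop :=
  ∀ x, f x ≠ 0 → ∀ v ∈ A, x v = a0 v

end Prob

end BH

namespace BH

/-- Removal of the vertices of `A` together with all edges incident to `A`. -/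
def removeVertices (E : Set (V × V)) (A : Set V) : Set (V × V) :=
  {p ∈ E | p.1 ∉ A ∧ p.2 ∉ A}

end BH

namespace BH

variable {V : Type*}

/-- Acyclicity phrased through reachability: no directed edge `u → v` admits a path from `v` back
to `u` along edges of the graph. -/
def NoReturn (E : Set (V × V)) : Prop :=
  ∀ u v, gPar E u v → ¬ Relation.ReflTransGen (fun a b => (a, b) ∈ E) v u

lemma exists_sequence_of_reflTransGen {r : V → V → Prop} {a b : V}
    (h : Relation.ReflTransGen r a b) :
    ∃ (n : ℕ) (g : ℕ → V), g 0 = a ∧ g n = b ∧ ∀ i < n, r (g i) (g (i + 1)) := by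
  induction h with
  | refl => exact ⟨0, fun _ => a, rfl, rfl, by simp⟩
  | @tail c d _ hcd ih =>
    obtain ⟨n, g, h0, hn, hg⟩ := ih
    refine ⟨n + 1, fun i => if i ≤ n then g i else d, by simp [h0], by simp, fun i hi => ?_⟩
    rcases Nat.lt_succ_iff_lt_or_eq.1 hi with h | h
    · have h1 : i ≤ n := h.le
      have h2 : i + 1 ≤ n := h
      simpa [h1, h2] using hg i h
    · subst h
      simpa [hn] using hcd

lemma IsChainGraph.noReturn {E : Set (V × V)} (hE : IsChainGraph E) : NoReturn E := by
  intro u v huv hvu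
  apply hE
  obtain ⟨n, g, h0, hn, hg⟩ := exists_sequence_of_reflTransGen hvu
  have hstep : ∀ a b, (a, b) ∈ E → gNbr E a b ∨ gPar E a b := fun a b hab => by
    by_cases h : (b, a) ∈ E
    · exact Or.inl ⟨hab, h⟩
    · exact Or.inr ⟨hab, h⟩
  have hlast : gPar E (g n) (g 0) := by rw [h0, hn]; exact huv
  let f : Fin (n + 1) → V := fun i => g i.val
  have key : (∀ i : Fin (n + 1), gNbr E (f i) (f (i + 1)) ∨ gPar E (f i) (f (i + 1))) ∧
      ∃ i : Fin (n + 1), gPar E (f i) (f (i + 1)) := by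
    refine ⟨fun i => ?_, Fin.last n, ?_⟩
    · rcases Fin.eq_castSucc_or_eq_last i with ⟨j, rfl⟩ | rfl
      · have : f (j.castSucc + 1) = g (j.val + 1) := by
          simp [f]
        rw [this]
        exact hstep _ _ (hg _ j.isLt)
      · right
        simpa [f] using hlast
    · simpa [f] using hlast
  exact ⟨n, f, key⟩

lemma gNbr_symm {E : Set (V × V)} {u v : V} (h : gNbr E u v) : gNbr E v u := ⟨h.2, h.1⟩

lemma gComp_mem_symm {E : Set (V × V)} {u v : V} (h : u ∈ gComp E v) : v ∈ gComp E u :=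
  have : Std.Symm (gNbr E) := ⟨fun _ _ => gNbr_symm⟩
  Relation.ReflTransGen.stdSymm.symm _ _ h

lemma eq_gComp_of_mem {E : Set (V × V)} {τ : Set V} (hτ : τ ∈ gComps E) {v : V} (hv : v ∈ τ) :
    τ = gComp E v := by
  obtain ⟨w, rfl⟩ := hτ
  ext u
  exact ⟨fun hu => (gComp_mem_symm hv).trans hu, fun hu => Relation.ReflTransGen.trans hv hu⟩

lemma gComp_mem_gComps (E : Set (V × V)) (v : V) : gComp E v ∈ gComps E := ⟨v, rfl⟩

lemma mem_gComp_self (E : Set (V × V)) (v : V) : v ∈ gComp E v := Relation.ReflTransGen.refl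

lemma gComps_nonempty {E : Set (V × V)} {τ : Set V} (hτ : τ ∈ gComps E) : τ.Nonempty := by
  obtain ⟨w, rfl⟩ := hτ
  exact ⟨w, mem_gComp_self E w⟩

lemma mem_of_gNbr {E : Set (V × V)} {τ : Set V} (hτ : τ ∈ gComps E) {u v : V} (hu : u ∈ τ)
    (h : gNbr E u v) : v ∈ τ := by
  rw [eq_gComp_of_mem hτ hu]
  exact Relation.ReflTransGen.single h

lemma gComps_pairwiseDisjoint {E : Set (V × V)} {σ τ : Set V} (hσ : σ ∈ gComps E)
    (hτ : τ ∈ gComps E) (h : σ ≠ τ) : Disjoint σ τ := by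
  rw [Set.disjoint_left]
  intro v hv hv'
  exact h ((eq_gComp_of_mem hσ hv).trans (eq_gComp_of_mem hτ hv').symm)

lemma reach_of_mem {E : Set (V × V)} {τ : Set V} (hτ : τ ∈ gComps E) {u v : V} (hu : u ∈ τ)
    (hv : v ∈ τ) : Relation.ReflTransGen (fun a b => (a, b) ∈ E) u v := by
  rw [eq_gComp_of_mem hτ hu] at hv
  exact Relation.ReflTransGen.mono (fun _ _ h => h.1) _ _ hv

lemma gComp_subset_of_closed {E : Set (V × V)} {D : Set V}
    (hD : ∀ v ∈ D, ∀ w, (v, w) ∈ E → w ∈ D) {v : V} (hv : v ∈ D) : gComp E v ⊆ D := by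
  rintro w (hw : Relation.ReflTransGen (gNbr E) v w)
  induction hw with
  | refl => exact hv
  | tail _ hbc ih => exact hD _ ih _ hbc.1

lemma disjoint_of_not_subset_closed {E : Set (V × V)} {D : Set V}
    (hD : ∀ v ∈ D, ∀ w, (v, w) ∈ E → w ∈ D) {τ : Set V} (hτ : τ ∈ gComps E) (h : ¬ τ ⊆ D) :
    Disjoint τ D := by
  rw [Set.disjoint_left]
  intro v hv hvD
  exact h (eq_gComp_of_mem hτ hv ▸ gComp_subset_of_closed hD hvD)

namespace NoReturn

variable {E : Set (V × V)} (hE : NoReturn E)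
include hE

lemma gNbr_of_mem {τ : Set V} (hτ : τ ∈ gComps E) {u v : V} (hu : u ∈ τ) (hv : v ∈ τ)
    (h : (u, v) ∈ E) : gNbr E u v := by
  refine ⟨h, ?_⟩
  by_contra h'
  exact hE u v ⟨h, h'⟩ (reach_of_mem hτ hv hu)

lemma notMem_of_gPar {τ : Set V} (hτ : τ ∈ gComps E) {u v : V} (hv : v ∈ τ)
    (h : gPar E u v) : u ∉ τ := fun hu => hE u v h (reach_of_mem hτ hv hu)

lemma mem_gPaTau {τ : Set V} (hτ : τ ∈ gComps E) {u : V} :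
    u ∈ gPaTau E τ ↔ ∃ v ∈ τ, gPar E u v := by
  simp only [gPaTau, gPaSet, Set.mem_sdiff, Set.mem_iUnion, Set.mem_ofPred_eq, exists_prop]
  refine ⟨fun h => h.1, fun h => ⟨h, ?_⟩⟩
  obtain ⟨v, hv, h⟩ := h
  exact hE.notMem_of_gPar hτ hv h

lemma mem_moral_gInduced {τ : Set V} (hτ : τ ∈ gComps E) {u v : V} (huv : u ≠ v) :
    (u, v) ∈ moral (gInduced E (τ ∪ gPaTau E τ)) ↔
      (u ∈ gPaTau E τ ∧ v ∈ gPaTau E τ) ∨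
      (((u, v) ∈ E ∨ (v, u) ∈ E) ∧ u ∈ τ ∪ gPaTau E τ ∧ v ∈ τ ∪ gPaTau E τ) := by
  set I := gInduced E (τ ∪ gPaTau E τ) with hI
  have hIE : ∀ {a b}, (a, b) ∈ I → (a, b) ∈ E ∧ a ∈ τ ∪ gPaTau E τ ∧ b ∈ τ ∪ gPaTau E τ :=
    fun h => h
  constructor
  · rintro (h | h | ⟨ρ, hρ, hu, hv, -⟩)
    · exact Or.inr ⟨Or.inl h.1, h.2⟩
    · exact Or.inr ⟨Or.inr h.1, h.2.2, h.2.1⟩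
    · left
      have key : ∀ a, a ∈ gBd I ρ → a ∈ gPaTau E τ := by
        rintro a ⟨ha, haρ⟩
        simp only [gPaSet, gNbSet, Set.mem_iUnion, Set.mem_union, Set.mem_ofPred_eq] at ha
        obtain ⟨z, hz, haz⟩ := ha
        have haz : (a, z) ∈ I := haz.elim (fun h => h.1) (fun h => h.1)
        obtain ⟨haz, haS, hzS⟩ := hIE haz
        refine haS.resolve_left fun haτ => ?_
        rcases hzS with hzτ | hzP
        · apply haρ
          rw [eq_gComp_of_mem hρ hz]
          have h1 := hE.gNbr_of_mem hτ haτ hzτ haz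
          exact Relation.ReflTransGen.single
            ⟨⟨h1.2, Or.inl hzτ, Or.inl haτ⟩, ⟨h1.1, Or.inl haτ, Or.inl hzτ⟩⟩
        · obtain ⟨t, ht, hzt⟩ := (hE.mem_gPaTau hτ).1 hzP
          exact hE z t hzt ((reach_of_mem hτ ht haτ).tail haz)
      exact ⟨key u hu, key v hv⟩
  · rintro (⟨hu, hv⟩ | ⟨h | h, hu, hv⟩)
    · refine Or.inr (Or.inr ?_)
      obtain ⟨t, ht⟩ := gComps_nonempty hτ
      have hsub : gComp I t ⊆ τ := by
        rw [eq_gComp_of_mem hτ ht]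
        intro w hw
        exact Relation.ReflTransGen.mono (fun a b h => ⟨h.1.1, h.2.1⟩) _ _ hw
      have hsup : τ ⊆ gComp I t := by
        intro w hw
        have hw' : Relation.ReflTransGen (gNbr E) t w := by
          rw [eq_gComp_of_mem hτ ht] at hw; exact hw
        clear hw
        suffices w ∈ τ ∧ w ∈ gComp I t from this.2
        induction hw' with
        | refl => exact ⟨ht, mem_gComp_self I t⟩
        | tail _ hbc ih =>
          have hc := mem_of_gNbr hτ ih.1 hbc
          exact ⟨hc, Relation.ReflTransGen.tail ih.2
            ⟨⟨hbc.1, Or.inl ih.1, Or.inl hc⟩, ⟨hbc.2, Or.inl hc, Or.inl ih.1⟩⟩⟩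
      have key : ∀ a, a ∈ gPaTau E τ → a ∈ gBd I (gComp I t) := by
        intro a ha
        refine ⟨?_, fun h => ha.2 (hsub h)⟩
        obtain ⟨z, hz, haz⟩ := (hE.mem_gPaTau hτ).1 ha
        simp only [gPaSet, gNbSet, Set.mem_iUnion, Set.mem_union, Set.mem_ofPred_eq]
        exact ⟨z, hsup hz, Or.inl ⟨⟨haz.1, Or.inr ha, Or.inl hz⟩, fun h => haz.2 h.1⟩⟩
      exact ⟨_, gComp_mem_gComps I t, key u hu, key v hv, huv⟩
    · exact Or.inl ⟨h, hu, hv⟩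
    · exact Or.inr (Or.inl ⟨h, hv, hu⟩)

lemma isCliqueIn_gPaTau {τ : Set V} (hτ : τ ∈ gComps E) :
    IsCliqueIn (moral (gInduced E (τ ∪ gPaTau E τ))) (gPaTau E τ) :=
  fun _ hu _ hv huv => (hE.mem_moral_gInduced hτ huv).2 (Or.inl ⟨hu, hv⟩)

lemma removeVertices (A : Set V) : NoReturn (removeVertices E A) := by
  intro u v huv hvu
  exact hE u v ⟨huv.1.1, fun h => huv.2 ⟨h, huv.1.2.2, huv.1.2.1⟩⟩
    (Relation.ReflTransGen.mono (fun _ _ h => h.1) _ _ hvu)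

/-- A nonempty set of vertices contains a vertex whose chain component has no parent in the
set. -/
lemma exists_initial [Finite V] {D : Set V} (hD : D.Nonempty) :
    ∃ v ∈ D, Disjoint (gPaTau E (gComp E v)) D := by
  let R : V → V → Prop := Relation.ReflTransGen (fun a b => (a, b) ∈ E)
  let lt : V → V → Prop := fun a b => R a b ∧ ¬ R b a
  have : IsTrans V lt := ⟨fun a b c hab hbc =>
    ⟨hab.1.trans hbc.1, fun h => hab.2 (hbc.1.trans h)⟩⟩
  have : Std.Irrefl lt := ⟨fun a h => h.2 h.1⟩
  obtain ⟨v, hv, hmin⟩ := (Finite.wellFounded_of_trans_of_irrefl lt).has_min D hD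
  refine ⟨v, hv, Set.disjoint_left.2 fun w hw hwD => hmin w hwD ?_⟩
  obtain ⟨u, hu, hwu⟩ := (hE.mem_gPaTau (gComp_mem_gComps E v)).1 hw
  have huv : R u v := reach_of_mem (gComp_mem_gComps E v) hu (mem_gComp_self E v)
  have hvu : R v u := reach_of_mem (gComp_mem_gComps E v) (mem_gComp_self E v) hu
  exact ⟨Relation.ReflTransGen.head hwu.1 huv, fun h => hE w u hwu (huv.trans h)⟩

end NoReturn

lemma gPar_removeVertices {E : Set (V × V)} {A : Set V} {u v : V} :
    gPar (removeVertices E A) u v ↔ gPar E u v ∧ u ∉ A ∧ v ∉ A := by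
  simp only [gPar, removeVertices, Set.mem_ofPred_eq]; tauto

lemma gNbr_removeVertices {E : Set (V × V)} {A : Set V} {u v : V} :
    gNbr (removeVertices E A) u v ↔ gNbr E u v ∧ u ∉ A ∧ v ∉ A := by
  simp only [gNbr, removeVertices, Set.mem_ofPred_eq]; tauto

/-- Every component after removal lies inside a component of the original graph. -/
lemma gComp_removeVertices_subset (E : Set (V × V)) (A : Set V) (v : V) :
    gComp (removeVertices E A) v ⊆ gComp E v :=
  fun _ h => Relation.ReflTransGen.mono (fun _ _ h => (gNbr_removeVertices.1 h).1) _ _ h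

lemma eq_singleton_of_mem_gComps_removeVertices {E : Set (V × V)} {A : Set V} {σ : Set V}
    (hσ : σ ∈ gComps (removeVertices E A)) {a : V} (ha : a ∈ σ) (haA : a ∈ A) : σ = {a} := by
  rw [eq_gComp_of_mem hσ ha]
  ext u
  constructor
  · intro hu
    rcases Relation.ReflTransGen.cases_head hu with h | ⟨c, hc, -⟩
    · exact h.symm
    · exact absurd haA (gNbr_removeVertices.1 hc).2.1
  · rintro rfl
    exact mem_gComp_self _ _

end BH

namespace BH

section Sums

variable {V : Type*} {X : V → Type*}

namespace DependsOn

lemma mono {F : (∀ v, X v) → ℝ} {S T : Set V} (h : DependsOn F S) (hST : S ⊆ T) :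
    DependsOn F T := fun x y hxy => h x y fun v hv => hxy v (hST hv)

lemma const (c : ℝ) (S : Set V) : DependsOn (fun _ : (∀ v, X v) => c) S := fun _ _ _ => rfl

lemma mul {F G : (∀ v, X v) → ℝ} {S : Set V} (hF : DependsOn F S) (hG : DependsOn G S) :
    DependsOn (fun x => F x * G x) S := fun x y h => by
  simp only [hF x y h, hG x y h]

lemma div {F G : (∀ v, X v) → ℝ} {S : Set V} (hF : DependsOn F S) (hG : DependsOn G S) :
    DependsOn (fun x => F x / G x) S := fun x y h => by
  simp only [hF x y h, hG x y h]

lemma prod {ι : Type*} {s : Finset ι} {F : ι → (∀ v, X v) → ℝ} {S : Set V}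
    (hF : ∀ i ∈ s, DependsOn (F i) S) : DependsOn (fun x => ∏ i ∈ s, F i x) S :=
  fun x y h => Finset.prod_congr rfl fun i hi => hF i hi x y h

end DependsOn

open Classical in
/-- The configuration equal to `x` on `W` and to `a` elsewhere. -/
noncomputable def overwrite (W : Set V) (a x : ∀ v, X v) : ∀ v, X v :=
  fun v => if v ∈ W then x v else a v

lemma overwrite_of_mem {W : Set V} {a x : ∀ v, X v} {v : V} (h : v ∈ W) :
    overwrite W a x v = x v := if_pos h

lemma overwrite_of_notMem {W : Set V} {a x : ∀ v, X v} {v : V} (h : v ∉ W) :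
    overwrite W a x v = a v := if_neg h

lemma DependsOn.apply_overwrite {F : (∀ v, X v) → ℝ} {S W : Set V} (h : DependsOn F S)
    (hSW : S ⊆ W) (a x : ∀ v, X v) : F (overwrite W a x) = F x :=
  h _ _ fun _ hv => overwrite_of_mem (hSW hv)

lemma DependsOn.comp_overwrite {F : (∀ v, X v) → ℝ} {S : Set V} (h : DependsOn F S)
    (W : Set V) (a : ∀ v, X v) : DependsOn (fun x => F (overwrite W a x)) (S ∩ W) := by
  intro x y hxy
  refine h _ _ fun v hv => ?_
  by_cases hW : v ∈ W
  · rw [overwrite_of_mem hW, overwrite_of_mem hW, hxy v ⟨hv, hW⟩]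
  · rw [overwrite_of_notMem hW, overwrite_of_notMem hW]

variable [Fintype V] [DecidableEq V] [∀ v, Fintype (X v)]

open Classical in
lemma sumOver_eq (τ : Set V) (F : (∀ v, X v) → ℝ) (x : ∀ v, X v) :
    sumOver τ F x = ∑ y with ∀ v, v ∉ τ → y v = x v, F y := by
  rw [sumOver, Finset.sum_filter]
  exact Finset.sum_congr rfl fun y _ => by simp [Set.indicator_apply]

lemma sumOver_congr {τ : Set V} {F G : (∀ v, X v) → ℝ} {x : ∀ v, X v}
    (h : ∀ y : ∀ v, X v, (∀ v, v ∉ τ → y v = x v) → F y = G y) :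
    sumOver τ F x = sumOver τ G x := by
  classical
  rw [sumOver_eq, sumOver_eq]
  exact Finset.sum_congr rfl fun y hy => h y (Finset.mem_filter.1 hy).2

lemma sumOver_nonneg {τ : Set V} {F : (∀ v, X v) → ℝ} (h : ∀ y, 0 ≤ F y) (x : ∀ v, X v) :
    0 ≤ sumOver τ F x := by
  classical
  rw [sumOver_eq]
  exact Finset.sum_nonneg fun y _ => h y

lemma le_sumOver {τ : Set V} {F : (∀ v, X v) → ℝ} (h : ∀ y, 0 ≤ F y) (x : ∀ v, X v) :
    F x ≤ sumOver τ F x := by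
  classical
  rw [sumOver_eq]
  exact Finset.single_le_sum (f := F) (fun y _ => h y) (by simp)

lemma sumOver_empty (F : (∀ v, X v) → ℝ) (x : ∀ v, X v) : sumOver ∅ F x = F x := by
  rw [sumOver, Finset.sum_eq_single x]
  · simp
  · intro y _ hyx
    have : ¬ ∀ v, y v = x v := fun h => hyx (funext h)
    simp [this]
  · simp

lemma sumOver_univ (F : (∀ v, X v) → ℝ) (x : ∀ v, X v) : sumOver Set.univ F x = ∑ y, F y := by
  classical
  rw [sumOver_eq]
  simp

lemma sumOver_sumOver {B C : Set V} (h : Disjoint B C) (F : (∀ v, X v) → ℝ) (x : ∀ v, X v) :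
    sumOver B (sumOver C F) x = sumOver (B ∪ C) F x := by
  classical
  simp only [sumOver_eq]
  rw [Finset.sum_sigma']
  refine Finset.sum_bij' (fun p _ => p.2) (fun z _ => ⟨overwrite B x z, z⟩) ?_ ?_ ?_ ?_ ?_
  · rintro ⟨y, z⟩ hyz
    simp only [Finset.mem_sigma, Finset.mem_filter, Finset.mem_univ, true_and] at hyz ⊢
    intro v hv
    rw [Set.mem_union, not_or] at hv
    rw [hyz.2 v hv.2, hyz.1 v hv.1]
  · intro z hz
    simp only [Finset.mem_sigma, Finset.mem_filter, Finset.mem_univ, true_and] at hz ⊢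
    refine ⟨fun v hv => overwrite_of_notMem hv, fun v hv => ?_⟩
    by_cases hB : v ∈ B
    · rw [overwrite_of_mem hB]
    · rw [overwrite_of_notMem hB]
      exact hz v (by simp [hv, hB])
  · rintro ⟨y, z⟩ hyz
    simp only [Finset.mem_sigma, Finset.mem_filter, Finset.mem_univ, true_and] at hyz
    have : overwrite B x z = y := by
      funext v
      by_cases hB : v ∈ B
      · rw [overwrite_of_mem hB]
        exact hyz.2 v (Set.disjoint_left.1 h hB)
      · rw [overwrite_of_notMem hB, hyz.1 v hB]
    simp [this]
  · intros; rfl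
  · intros; rfl

lemma sumOver_mul_left {B S : Set V} {F : (∀ v, X v) → ℝ} (hF : DependsOn F S)
    (hS : Disjoint S B) (G : (∀ v, X v) → ℝ) (x : ∀ v, X v) :
    sumOver B (fun y => F y * G y) x = F x * sumOver B G x := by
  classical
  rw [sumOver_eq, sumOver_eq, Finset.mul_sum]
  refine Finset.sum_congr rfl fun y hy => ?_
  rw [hF y x fun v hv => (Finset.mem_filter.1 hy).2 v (Set.disjoint_left.1 hS hv)]

lemma DependsOn.sumOver {F : (∀ v, X v) → ℝ} {S : Set V} (hF : DependsOn F S) (B : Set V) :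
    DependsOn (BH.sumOver B F) (S \ B) := by
  classical
  intro x x' hx
  rw [sumOver_eq, sumOver_eq]
  refine Finset.sum_bij' (fun y _ => overwrite B x' y) (fun y _ => overwrite B x y) ?_ ?_ ?_ ?_ ?_
  · intro y _
    simpa using fun v hv => overwrite_of_notMem hv
  · intro y _
    simpa using fun v hv => overwrite_of_notMem hv
  · intro y hy
    have hy := (Finset.mem_filter.1 hy).2
    funext v
    by_cases hB : v ∈ B
    · rw [overwrite_of_mem hB, overwrite_of_mem hB]
    · rw [overwrite_of_notMem hB, hy v hB]
  · intro y hy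
    have hy := (Finset.mem_filter.1 hy).2
    funext v
    by_cases hB : v ∈ B
    · rw [overwrite_of_mem hB, overwrite_of_mem hB]
    · rw [overwrite_of_notMem hB, hy v hB]
  · intro y hy
    have hy := (Finset.mem_filter.1 hy).2
    refine hF _ _ fun v hv => ?_
    by_cases hB : v ∈ B
    · rw [overwrite_of_mem hB]
    · rw [overwrite_of_notMem hB, hy v hB, hx v ⟨hv, hB⟩]

/-- A product of functions, each of which is insensitive to the blocks of the others, may be
summed block by block. -/
lemma sumOver_prod {ι : Type*} (s : Finset ι) (B S : ι → Set V) (F : ι → (∀ v, X v) → ℝ)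
    (hF : ∀ i ∈ s, DependsOn (F i) (S i))
    (hS : ∀ i ∈ s, ∀ j ∈ s, i ≠ j → Disjoint (S i) (B j))
    (hB : ∀ i ∈ s, ∀ j ∈ s, i ≠ j → Disjoint (B i) (B j)) (x : ∀ v, X v) :
    sumOver (⋃ i ∈ s, B i) (fun y => ∏ i ∈ s, F i y) x = ∏ i ∈ s, sumOver (B i) (F i) x := by
  classical
  induction s using Finset.induction_on generalizing x with
  | empty => simp [sumOver_empty]
  | insert i s hi ih =>
    have hne : ∀ j ∈ s, i ≠ j := fun j hj h => hi (h ▸ hj)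
    have ih' := ih (fun j hj => hF j (Finset.mem_insert_of_mem hj))
      (fun j hj k hk => hS j (Finset.mem_insert_of_mem hj) k (Finset.mem_insert_of_mem hk))
      (fun j hj k hk => hB j (Finset.mem_insert_of_mem hj) k (Finset.mem_insert_of_mem hk))
    have hii := Finset.mem_insert_self i s
    rw [Finset.set_biUnion_insert, ← sumOver_sumOver, Finset.prod_insert hi, mul_comm]
    · have h1 : ∀ y, sumOver (⋃ j ∈ s, B j) (fun y => ∏ j ∈ insert i s, F j y) y
          = (∏ j ∈ s, sumOver (B j) (F j) y) * F i y := by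
        intro y
        simp only [Finset.prod_insert hi]
        rw [sumOver_mul_left (hF i hii), ih', mul_comm]
        simp only [Set.disjoint_iUnion_right]
        exact fun j hj => hS i hii j (Finset.mem_insert_of_mem hj) (hne j hj)
      rw [sumOver_congr (fun y _ => h1 y)]
      refine sumOver_mul_left (S := ⋃ j ∈ s, S j) (DependsOn.prod fun j hj => ?_) ?_ _ _
      · exact ((hF j (Finset.mem_insert_of_mem hj)).sumOver (B j)).mono
          (Set.sdiff_subset.trans (Set.subset_biUnion_of_mem (u := S) hj))
      · simp only [Set.disjoint_iUnion_left]
        exact fun j hj => hS j (Finset.mem_insert_of_mem hj) i hii (hne j hj).symm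
    · simp only [Set.disjoint_iUnion_right]
      exact fun j hj => hB i hii j (Finset.mem_insert_of_mem hj) (hne j hj)

lemma marginal_eq_sumOver (f : (∀ v, X v) → ℝ) (S : Set V) (x : ∀ v, X v) :
    marginal f S x = sumOver Sᶜ f x := by
  simp [marginal, sumOver]

lemma marginal_dependsOn (f : (∀ v, X v) → ℝ) (S : Set V) : DependsOn (marginal f S) S := by
  intro x y h
  rw [marginal_eq_sumOver, marginal_eq_sumOver]
  refine DependsOn.sumOver (S := Set.univ) (fun a b hab => ?_) Sᶜ x y fun v hv =>
    h v (by simpa using hv)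
  rw [funext fun v => hab v (Set.mem_univ v)]

lemma condM_dependsOn (f : (∀ v, X v) → ℝ) (S T : Set V) : DependsOn (condM f S T) (S ∪ T) :=
  (marginal_dependsOn f (S ∪ T)).div ((marginal_dependsOn f T).mono Set.subset_union_right)

lemma sumOver_marginal (f : (∀ v, X v) → ℝ) {B S : Set V} (h : B ⊆ S) (x : ∀ v, X v) :
    sumOver B (marginal f S) x = marginal f (S \ B) x := by
  rw [sumOver_congr (fun y _ => marginal_eq_sumOver f S y), sumOver_sumOver, marginal_eq_sumOver]
  · congr 1
    ext v
    simp only [Set.mem_union, Set.mem_compl_iff, Set.mem_sdiff]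
    tauto
  · exact Set.disjoint_left.2 fun v hv hv' => hv' (h hv)

lemma marginal_univ (f : (∀ v, X v) → ℝ) (x : ∀ v, X v) : marginal f Set.univ x = f x := by
  rw [marginal_eq_sumOver, Set.compl_univ, sumOver_empty]

lemma condM_empty {f : (∀ v, X v) → ℝ} {T : Set V} {x : ∀ v, X v}
    (hx : marginal f T x ≠ 0) : condM f ∅ T x = 1 := by
  rw [condM, Set.empty_union, div_self hx]

namespace IsPMF

variable {f : (∀ v, X v) → ℝ} (hf : IsPMF f)
include hf

lemma marginal_nonneg (S : Set V) (x : ∀ v, X v) : 0 ≤ marginal f S x := by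
  rw [marginal_eq_sumOver]
  exact sumOver_nonneg hf.1 x

lemma marginal_empty (x : ∀ v, X v) : marginal f ∅ x = 1 := by
  rw [marginal_eq_sumOver, Set.compl_empty, sumOver_univ, hf.2]

lemma marginal_anti {S T : Set V} (h : S ⊆ T) (x : ∀ v, X v) :
    marginal f T x ≤ marginal f S x := by
  have : S = T \ (T \ S) := by rw [Set.sdiff_sdiff_cancel_left h]
  rw [this, ← sumOver_marginal f Set.sdiff_subset]
  exact le_sumOver (hf.marginal_nonneg T) x

lemma marginal_eq_zero {S T : Set V} (h : S ⊆ T) {x : ∀ v, X v} (hS : marginal f S x = 0) :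
    marginal f T x = 0 :=
  le_antisymm (hS ▸ hf.marginal_anti h x) (hf.marginal_nonneg T x)

lemma condM_nonneg (S T : Set V) (x : ∀ v, X v) : 0 ≤ condM f S T x :=
  div_nonneg (hf.marginal_nonneg _ x) (hf.marginal_nonneg _ x)

lemma condM_mul (S T : Set V) (x : ∀ v, X v) :
    marginal f T x * condM f S T x = marginal f (S ∪ T) x := by
  by_cases h : marginal f T x = 0
  · rw [h, zero_mul, hf.marginal_eq_zero Set.subset_union_right h]
  · rw [condM, mul_div_cancel₀ _ h]

lemma sumOver_condM {S T : Set V} (h : Disjoint S T) {x : ∀ v, X v} (hx : marginal f T x ≠ 0) :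
    sumOver S (condM f S T) x = 1 := by
  have h1 : sumOver S (fun y => marginal f T y * condM f S T y) x
      = marginal f T x * sumOver S (condM f S T) x :=
    sumOver_mul_left (marginal_dependsOn f T) h.symm _ x
  rw [sumOver_congr (fun y _ => hf.condM_mul S T y), sumOver_marginal f Set.subset_union_left,
    Set.union_sdiff_cancel_left (by simpa using h.inter_eq.le)] at h1
  exact mul_left_cancel₀ hx (by rw [← h1, mul_one])

end IsPMF

lemma ConsistentWith.marginal_eq_zero {f : (∀ v, X v) → ℝ} {A : Set V} {a0 : ∀ v, X v}
    (hcons : ConsistentWith f A a0) {S : Set V} {x : ∀ v, X v} {v : V} (hvA : v ∈ A)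
    (hvS : v ∈ S) (hx : x v ≠ a0 v) : marginal f S x = 0 := by
  refine Finset.sum_eq_zero fun y _ => ?_
  rw [Set.indicator_apply_eq_zero]
  intro hy
  by_contra h
  exact hx ((hy v hvS).symm.trans (hcons y h v hvA))

lemma ConsistentWith.marginal_union {f : (∀ v, X v) → ℝ} {A : Set V} {a0 : ∀ v, X v}
    (hcons : ConsistentWith f A a0) {S T : Set V} (hT : T ⊆ A) {x : ∀ v, X v}
    (hx : ∀ v ∈ T, x v = a0 v) : marginal f (S ∪ T) x = marginal f S x := by
  classical
  refine Finset.sum_congr rfl fun y _ => ?_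
  by_cases hy : f y = 0
  · simp [Set.indicator_apply, hy]
  · have h : ∀ v ∈ T, y v = x v := fun v hv => (hcons y hy v (hT hv)).trans (hx v hv).symm
    simp only [Set.indicator_apply]
    congr 1
    simp only [Set.mem_ofPred_eq, eq_iff_iff, Set.mem_union]
    exact ⟨fun h' v hv => h' v (Or.inl hv), fun h' v hv => hv.elim (h' v) (h v)⟩

end Sums

end BH

namespace BH

section CliqueProducts

variable {V : Type*} {X : V → Type*}

lemma exists_maxClique [Finite V] {U : Set (V × V)} {K : Set V} (hK : IsCliqueIn U K)
    (hne : K.Nonempty) :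
    ∃ L ∈ maxCliques U, K ⊆ L := by
  obtain ⟨L, hKL, hL⟩ := Finite.exists_le_maximal (p := IsCliqueIn U) hK
  exact ⟨L, ⟨hne.mono hKL, Set.subset_univ L, hL.1,
    fun K' hLK' _ hK' => (hL.2 hK' hLK').antisymm hLK'⟩, hKL⟩

/-- `F` is a product of nonnegative functions, one for each maximal clique of `U`, each depending
only on the coordinates of its clique. -/
def IsCliqueProd (U : Set (V × V)) (F : (∀ v, X v) → ℝ) : Prop :=
  ∃ ψ : Set V → (∀ v, X v) → ℝ,
    (∀ K ∈ maxCliques U, (∀ x, 0 ≤ ψ K x) ∧ DependsOn (ψ K) K) ∧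
    ∀ x, F x = ∏ᶠ K ∈ maxCliques U, ψ K x

namespace IsCliqueProd

variable {U : Set (V × V)} {F G : (∀ v, X v) → ℝ}

lemma congr (hF : IsCliqueProd U F) (h : ∀ x, G x = F x) : IsCliqueProd U G := by
  obtain ⟨ψ, hψ, hF⟩ := hF
  exact ⟨ψ, hψ, fun x => (h x).trans (hF x)⟩

lemma one : IsCliqueProd U (fun _ : (∀ v, X v) => (1 : ℝ)) :=
  ⟨fun _ _ => 1, fun K _ => ⟨fun _ => zero_le_one, DependsOn.const 1 K⟩, fun x => by simp⟩

variable [Fintype V]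

lemma mul (hF : IsCliqueProd U F) (hG : IsCliqueProd U G) :
    IsCliqueProd U (fun x => F x * G x) := by
  obtain ⟨ψ, hψ, hF⟩ := hF
  obtain ⟨φ, hφ, hG⟩ := hG
  refine ⟨fun K x => ψ K x * φ K x, fun K hK => ⟨fun x => mul_nonneg ((hψ K hK).1 x)
    ((hφ K hK).1 x), (hψ K hK).2.mul (hφ K hK).2⟩, fun x => ?_⟩
  beta_reduce
  rw [hF, hG, finprod_mem_mul_distrib (Set.toFinite _)]

lemma prod {ι : Type*} (s : Finset ι) {H : ι → (∀ v, X v) → ℝ}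
    (h : ∀ i ∈ s, IsCliqueProd U (H i)) : IsCliqueProd U (fun x => ∏ i ∈ s, H i x) := by
  classical
  induction s using Finset.induction_on with
  | empty => simpa using one
  | insert i s hi ih =>
    simp only [Finset.prod_insert hi]
    exact (h i (Finset.mem_insert_self i s)).mul
      (ih fun j hj => h j (Finset.mem_insert_of_mem hj))

lemma of_clique [Nonempty V] {K : Set V} (hK : IsCliqueIn U K) (h0 : ∀ x, 0 ≤ F x)
    (hF : DependsOn F K) : IsCliqueProd U F := by
  classical
  obtain ⟨L, hL, hKL⟩ : ∃ L ∈ maxCliques U, K ⊆ L := by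
    rcases K.eq_empty_or_nonempty with rfl | hne
    · obtain ⟨v⟩ := ‹Nonempty V›
      obtain ⟨L, hL, -⟩ := exists_maxClique (U := U) (K := {v})
        (fun a ha b hb hab => absurd (ha.trans hb.symm) hab) (Set.singleton_nonempty v)
      exact ⟨L, hL, Set.empty_subset L⟩
    · exact exists_maxClique hK hne
  refine ⟨fun M x => if M = L then F x else 1, fun M _ => ?_, fun x => ?_⟩
  · by_cases hM : M = L
    · subst hM
      simpa using ⟨h0, hF.mono hKL⟩
    · simpa [hM] using DependsOn.const 1 M
  · rw [finprod_mem_eq_finite_toFinset_prod _ (Set.toFinite _), Finset.prod_ite_eq']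
    simp [hL]

lemma of_singleton (v : V) (h0 : ∀ x, 0 ≤ F x) (hF : DependsOn F {v}) : IsCliqueProd U F :=
  have : Nonempty V := ⟨v⟩
  of_clique (fun _ ha _ hb hab => absurd (ha.trans hb.symm) hab) h0 hF

lemma comp_overwrite [Nonempty V] {U' : Set (V × V)} (hF : IsCliqueProd U F) (W : Set V)
    (a : ∀ v, X v) (h : ∀ K ∈ maxCliques U, IsCliqueIn U' (K ∩ W)) :
    IsCliqueProd U' (fun x => F (overwrite W a x)) := by
  obtain ⟨ψ, hψ, hF⟩ := hF
  refine (prod (Set.toFinite (maxCliques U)).toFinset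
    (H := fun K x => ψ K (overwrite W a x)) fun K hK => ?_).congr fun x => ?_
  · rw [Set.Finite.mem_toFinset] at hK
    exact of_clique (h K hK) (fun x => (hψ K hK).1 _) ((hψ K hK).2.comp_overwrite W a)
  · rw [hF, finprod_mem_eq_finite_toFinset_prod _ (Set.toFinite _)]

lemma mono [Nonempty V] {U' : Set (V × V)} (hF : IsCliqueProd U F)
    (h : ∀ K, IsCliqueIn U K → IsCliqueIn U' K) : IsCliqueProd U' F := by
  obtain ⟨ψ, hψ, hF⟩ := hF
  refine (prod (Set.toFinite (maxCliques U)).toFinset (H := ψ) fun K hK => ?_).congr fun x => ?_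
  · rw [Set.Finite.mem_toFinset] at hK
    exact of_clique (h K hK.2.2.1) (hψ K hK).1 (hψ K hK).2
  · rw [hF, finprod_mem_eq_finite_toFinset_prod _ (Set.toFinite _)]

end IsCliqueProd

lemma IsCliqueIn.mono {V : Type*} {U : Set (V × V)} {K L : Set V} (h : IsCliqueIn U L)
    (hKL : K ⊆ L) : IsCliqueIn U K := fun u hu v hv huv => h u (hKL hu) v (hKL hv) huv

end CliqueProducts

section Kernels

variable {V : Type*} [Fintype V]

/-- The chain components of a graph, as a finset. -/
noncomputable def comps (E : Set (V × V)) : Finset (Set V) := (gComps E).toFinite.toFinset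

lemma mem_comps {E : Set (V × V)} {τ : Set V} : τ ∈ comps E ↔ τ ∈ gComps E :=
  Set.Finite.mem_toFinset _

variable [DecidableEq V] {X : V → Type*} [∀ v, Fintype (X v)]

open Classical in
/-- The product of normalized kernels over a set of vertices closed under edges sums to one. -/
lemma NoReturn.sumOver_prod_comps {E : Set (V × V)} (hE : NoReturn E)
    {k : Set V → (∀ v, X v) → ℝ} (hk : ∀ τ ∈ gComps E, DependsOn (k τ) (τ ∪ gPaTau E τ))
    (hk1 : ∀ τ ∈ gComps E, ∀ x, sumOver τ (k τ) x = 1) {D : Set V}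
    (hD : ∀ v ∈ D, ∀ w, (v, w) ∈ E → w ∈ D) (x : ∀ v, X v) :
    sumOver D (fun y => ∏ τ ∈ comps E with τ ⊆ D, k τ y) x = 1 := by
  induction hn : D.ncard using Nat.strong_induction_on generalizing D x with
  | _ n ih =>
  subst hn
  rcases D.eq_empty_or_nonempty with rfl | hne
  · rw [sumOver_empty]
    refine Finset.prod_eq_one fun τ hτ => ?_
    rw [Finset.mem_filter, mem_comps, Set.subset_empty_iff] at hτ
    exact absurd hτ.2 (gComps_nonempty hτ.1).ne_empty
  obtain ⟨v, hv, hpa⟩ := hE.exists_initial hne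
  set τ := gComp E v with hτdef
  have hτ : τ ∈ gComps E := gComp_mem_gComps E v
  have hvτ : v ∈ τ := mem_gComp_self E v
  have hτD : τ ⊆ D := gComp_subset_of_closed hD hv
  have hD' : ∀ u ∈ D \ τ, ∀ w, (u, w) ∈ E → w ∈ D \ τ := by
    rintro u ⟨hu, huτ⟩ w huw
    refine ⟨hD u hu w huw, fun hw => ?_⟩
    by_cases h : (w, u) ∈ E
    · exact huτ (mem_of_gNbr hτ hw ⟨h, huw⟩)
    · exact Set.disjoint_left.1 hpa ((hE.mem_gPaTau hτ).2 ⟨w, hw, huw, h⟩) hu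
  have hcard : (D \ τ).ncard < D.ncard :=
    Set.ncard_lt_ncard ⟨Set.sdiff_subset, fun h => (h hv).2 hvτ⟩
  have hins : (comps E).filter (fun σ => σ ⊆ D)
      = insert τ ((comps E).filter (fun σ => σ ⊆ D \ τ)) := by
    ext σ
    simp only [Finset.mem_filter, mem_comps, Finset.mem_insert]
    constructor
    · rintro ⟨hσ, hσD⟩
      by_cases h : σ = τ
      · exact Or.inl h
      · exact Or.inr ⟨hσ, Set.subset_sdiff.2 ⟨hσD, gComps_pairwiseDisjoint hσ hτ h⟩⟩
    · rintro (rfl | ⟨hσ, hσD⟩)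
      · exact ⟨hτ, hτD⟩
      · exact ⟨hσ, hσD.trans Set.sdiff_subset⟩
  have hnot : τ ∉ (comps E).filter (fun σ => σ ⊆ D \ τ) := fun h =>
    ((Finset.mem_filter.1 h).2 hvτ).2 hvτ
  have hsplit : D = τ ∪ D \ τ := (Set.union_sdiff_cancel hτD).symm
  have hdisj : Disjoint (τ ∪ gPaTau E τ) (D \ τ) := by
    rw [Set.disjoint_union_left]
    exact ⟨Set.disjoint_sdiff_right, hpa.mono_right Set.sdiff_subset⟩
  calc sumOver D (fun y => ∏ σ ∈ comps E with σ ⊆ D, k σ y) x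
      = sumOver (τ ∪ D \ τ) (fun y => k τ y * ∏ σ ∈ comps E with σ ⊆ D \ τ, k σ y) x := by
        rw [← hsplit]
        refine sumOver_congr fun y _ => ?_
        rw [hins, Finset.prod_insert hnot]
    _ = sumOver τ (k τ) x := by
        rw [← sumOver_sumOver Set.disjoint_sdiff_right]
        refine sumOver_congr fun y _ => ?_
        rw [sumOver_mul_left (hk τ hτ) hdisj, ih _ hcard hD' y rfl, mul_one]
    _ = 1 := hk1 τ hτ x

/-- A pmf dominated by a product of normalized kernels equals that product. -/
lemma NoReturn.eq_prod_comps {E : Set (V × V)} (hE : NoReturn E)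
    {k : Set V → (∀ v, X v) → ℝ} (hk : ∀ τ ∈ gComps E, DependsOn (k τ) (τ ∪ gPaTau E τ))
    (hk1 : ∀ τ ∈ gComps E, ∀ x, sumOver τ (k τ) x = 1) {f : (∀ v, X v) → ℝ} (hf : IsPMF f)
    (hle : ∀ x, f x ≤ ∏ τ ∈ comps E, k τ x) (x : ∀ v, X v) : f x = ∏ τ ∈ comps E, k τ x := by
  classical
  have h := hE.sumOver_prod_comps hk hk1 (D := Set.univ) (fun _ _ w _ => Set.mem_univ w) x
  rw [sumOver_univ, ← hf.2] at h
  simp only [Set.subset_univ, Finset.filter_true] at h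
  exact (Finset.sum_eq_sum_iff_of_le fun y _ => hle y).1 h.symm x (Finset.mem_univ x)

open Classical in
/-- The marginal of a product of normalized kernels on the complement of a set closed under edges
is the product of the remaining kernels. -/
lemma NoReturn.marginal_compl_eq_prod {E : Set (V × V)} (hE : NoReturn E)
    {k : Set V → (∀ v, X v) → ℝ} (hk : ∀ τ ∈ gComps E, DependsOn (k τ) (τ ∪ gPaTau E τ))
    (hk1 : ∀ τ ∈ gComps E, ∀ x, sumOver τ (k τ) x = 1) {f : (∀ v, X v) → ℝ}
    (hfk : ∀ x, f x = ∏ τ ∈ comps E, k τ x) {D : Set V}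
    (hD : ∀ v ∈ D, ∀ w, (v, w) ∈ E → w ∈ D) (x : ∀ v, X v) :
    marginal f Dᶜ x = ∏ τ ∈ comps E with ¬ τ ⊆ D, k τ x := by
  have hdep : DependsOn (fun y => ∏ τ ∈ comps E with ¬ τ ⊆ D, k τ y) Dᶜ := by
    refine DependsOn.prod fun τ hτ => ?_
    rw [Finset.mem_filter, mem_comps] at hτ
    refine (hk τ hτ.1).mono (Set.union_subset ?_ fun u hu huD => ?_)
    · exact (disjoint_of_not_subset_closed hD hτ.1 hτ.2).subset_compl_right
    · obtain ⟨w, hw, huw⟩ := (hE.mem_gPaTau hτ.1).1 hu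
      exact Set.disjoint_left.1 (disjoint_of_not_subset_closed hD hτ.1 hτ.2) hw
        (hD u huD w huw.1)
  rw [marginal_eq_sumOver, compl_compl, ← mul_one (∏ τ ∈ comps E with ¬ τ ⊆ D, k τ x),
    ← hE.sumOver_prod_comps hk hk1 hD x, ← sumOver_mul_left hdep disjoint_compl_left]
  refine sumOver_congr fun y _ => ?_
  rw [hfk, ← Finset.prod_filter_mul_prod_filter_not (comps E) (fun τ => τ ⊆ D), mul_comm]

open Classical in
/-- A version of the conditional pmf that is normalized everywhere: it is uniform where the
conditioning event has mass zero. -/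
noncomputable def fullCond (f : (∀ v, X v) → ℝ) (S T : Set V) (x : ∀ v, X v) : ℝ :=
  if marginal f T x = 0 then (sumOver S (fun _ => 1) x)⁻¹ else condM f S T x

lemma fullCond_dependsOn (f : (∀ v, X v) → ℝ) (S T : Set V) :
    DependsOn (fullCond f S T) (S ∪ T) := by
  intro x y h
  have h1 := marginal_dependsOn f T x y fun v hv => h v (Or.inr hv)
  have h2 := condM_dependsOn f S T x y h
  have h3 := (DependsOn.const (X := X) 1 ∅).sumOver S x y (by simp)
  simp only [fullCond, h1, h2, h3]

lemma fullCond_of_ne {f : (∀ v, X v) → ℝ} {T : Set V} {x : ∀ v, X v}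
    (h : marginal f T x ≠ 0) (S : Set V) : fullCond f S T x = condM f S T x := if_neg h

lemma condM_of_eq_zero {f : (∀ v, X v) → ℝ} {T : Set V} {x : ∀ v, X v}
    (h : marginal f T x = 0) (S : Set V) : condM f S T x = 0 := by
  rw [condM, h, div_zero]

lemma condM_le_fullCond (f : (∀ v, X v) → ℝ) (S T : Set V) (x : ∀ v, X v) :
    condM f S T x ≤ fullCond f S T x := by
  by_cases h : marginal f T x = 0
  · rw [condM_of_eq_zero h, fullCond, if_pos h]
    exact inv_nonneg.2 (sumOver_nonneg (fun _ => zero_le_one) x)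
  · exact (fullCond_of_ne h S).ge

lemma IsPMF.sumOver_fullCond {f : (∀ v, X v) → ℝ} (hf : IsPMF f) {S T : Set V}
    (h : Disjoint S T) (x : ∀ v, X v) : sumOver S (fullCond f S T) x = 1 := by
  have hT : ∀ y : ∀ v, X v, (∀ v, v ∉ S → y v = x v) → marginal f T y = marginal f T x :=
    fun y hy => marginal_dependsOn f T y x fun v hv => hy v (Set.disjoint_right.1 h hv)
  by_cases h0 : marginal f T x = 0
  · have hpos : sumOver S (fun _ : (∀ v, X v) => (1 : ℝ)) x ≠ 0 :=
      (zero_lt_one.trans_le (le_sumOver (F := fun _ => (1 : ℝ)) (fun _ => zero_le_one) x)).ne'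
    have hc : ∀ y : ∀ v, X v, (∀ v, v ∉ S → y v = x v) →
        fullCond f S T y = (sumOver S (fun _ => 1) x)⁻¹ * 1 := by
      intro y hy
      rw [fullCond, if_pos ((hT y hy).trans h0), mul_one,
        (DependsOn.const (X := X) 1 ∅).sumOver S y x (by simp)]
    rw [sumOver_congr hc, sumOver_mul_left (DependsOn.const _ ∅) (Set.empty_disjoint S),
      inv_mul_cancel₀ hpos]
  · rw [← hf.sumOver_condM h h0]
    exact sumOver_congr fun y hy => fullCond_of_ne (by rwa [hT y hy]) S

end Kernels

end BH

namespace BH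

lemma union_inter_diff {V : Type*} (P τ A : Set V) : (P ∪ (τ ∩ A)) \ A = P \ A := by
  ext v; simp only [Set.mem_sdiff, Set.mem_union, Set.mem_inter_iff]; tauto

section Intervention

variable {V : Type*} [Fintype V] [DecidableEq V] {X : V → Type*} [∀ v, Fintype (X v)]
  {f : (∀ v, X v) → ℝ} {A : Set V} {a0 : ∀ v, X v}

lemma ConsistentWith.marginal_diff (hcons : ConsistentWith f A a0) {S : Set V} {x : ∀ v, X v}
    (hx : ∀ v ∈ S ∩ A, x v = a0 v) : marginal f S x = marginal f (S \ A) x := by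
  rw [← hcons.marginal_union (S := S \ A) Set.inter_subset_right hx, Set.sdiff_union_inter]

lemma ConsistentWith.condM_eq (hcons : ConsistentWith f A a0) {S T : Set V} {x : ∀ v, X v}
    (hS : Disjoint S A) (hx : ∀ v ∈ T ∩ A, x v = a0 v) :
    condM f S T x = condM f S (T \ A) x := by
  have h1 : (S ∪ T) \ A = S ∪ T \ A := by rw [Set.union_sdiff_distrib, hS.sdiff_eq_left]
  rw [condM, condM, hcons.marginal_diff hx, hcons.marginal_diff (S := S ∪ T), h1]
  rintro v ⟨hv | hv, hvA⟩
  · exact absurd hvA (Set.disjoint_left.1 hS hv)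
  · exact hx v ⟨hv, hvA⟩

lemma ConsistentWith.condM_eq_zero (hcons : ConsistentWith f A a0) {S T : Set V} {x : ∀ v, X v}
    {v : V} (hv : v ∈ T ∩ A) (hx : x v ≠ a0 v) : condM f S T x = 0 :=
  condM_of_eq_zero (hcons.marginal_eq_zero hv.2 hv.1 hx) S

/-- The clique factorization of a conditional pmf given an intervention is equivalent to the
conditional pmf of the remaining variables being itself a product over cliques. -/
lemma NoReturn.clique_factorization_iff {E : Set (V × V)} (hE : NoReturn E) (hf : IsPMF f)
    (hcons : ConsistentWith f A a0) {τ : Set V} (hτ : τ ∈ gComps E) :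
    (∃ ψ : Set V → (∀ v, X v) → ℝ,
      (∀ K ∈ maxCliques (moral (gInduced E (τ ∪ gPaTau E τ))),
        (∀ x, 0 ≤ ψ K x) ∧ DependsOn (ψ K) K) ∧
      ∀ x, condM f (τ \ A) (gPaTau E τ ∪ (τ ∩ A)) x
        = (∏ᶠ K ∈ maxCliques (moral (gInduced E (τ ∪ gPaTau E τ))), ψ K x) /
          sumOver (τ \ A)
            (fun y => ∏ᶠ K ∈ maxCliques (moral (gInduced E (τ ∪ gPaTau E τ))), ψ K y) x) ↔
    IsCliqueProd (moral (gInduced E (τ ∪ gPaTau E τ)))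
      (condM f (τ \ A) (gPaTau E τ \ A)) := by
  classical
  obtain ⟨v₀, -⟩ := gComps_nonempty hτ
  have : Nonempty V := ⟨v₀⟩
  set U := moral (gInduced E (τ ∪ gPaTau E τ)) with hU
  set P := gPaTau E τ with hP
  have hPτ : Disjoint P τ := Set.disjoint_left.2 fun u hu => hu.2
  have hSA : Disjoint (τ \ A) A := Set.disjoint_sdiff_left
  constructor
  · rintro ⟨ψ, hψ, hc⟩
    set Φ : (∀ v, X v) → ℝ := fun y => ∏ᶠ K ∈ maxCliques U, ψ K y with hΦ
    have hΦ0 : ∀ y, 0 ≤ Φ y := fun y => by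
      simp only [hΦ]
      rw [finprod_mem_eq_finite_toFinset_prod _ (Set.toFinite _)]
      exact Finset.prod_nonneg fun K hK => (hψ K ((Set.Finite.mem_toFinset _).1 hK)).1 y
    have hΦU : IsCliqueProd U Φ := ⟨ψ, hψ, fun _ => rfl⟩
    set W : Set V := (τ ∪ P) \ A with hW
    have h1 : IsCliqueProd U (fun x => Φ (overwrite W a0 x)) :=
      hΦU.comp_overwrite W a0 fun K hK => hK.2.2.1.mono Set.inter_subset_left
    have h2 : IsCliqueProd U (fun x => (sumOver (τ \ A) Φ (overwrite W a0 x))⁻¹) := by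
      refine IsCliqueProd.of_clique ((hE.isCliqueIn_gPaTau hτ).mono
        (Set.sdiff_subset (t := A))) (fun x => inv_nonneg.2 (sumOver_nonneg hΦ0 _)) ?_
      intro x y hxy
      have hΦdep : DependsOn Φ Set.univ := fun x y h => by rw [funext fun v => h v trivial]
      refine congrArg Inv.inv ((hΦdep.sumOver (τ \ A)).comp_overwrite W a0 x y ?_)
      rintro v ⟨⟨-, hv⟩, hvτ | hvP, hvA⟩
      · exact absurd ⟨hvτ, hvA⟩ hv
      · exact hxy v ⟨hvP, hvA⟩
    refine (h1.mul h2).congr fun x => ?_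
    rw [← div_eq_mul_inv, ← hc, hcons.condM_eq (T := P ∪ (τ ∩ A)) hSA
      (fun v hv => overwrite_of_notMem fun h => h.2 hv.2), union_inter_diff]
    exact ((condM_dependsOn f _ _).apply_overwrite (by
      rw [hW, Set.union_sdiff_distrib]) a0 x).symm
  · intro h
    have hind : ∀ v, IsCliqueProd U (fun x : (∀ v, X v) => if x v = a0 v then (1 : ℝ) else 0) :=
      fun v => IsCliqueProd.of_singleton v (fun x => by split_ifs <;> norm_num)
        (fun x y hxy => by rw [hxy v rfl])
    have hc : IsCliqueProd U (condM f (τ \ A) (P ∪ (τ ∩ A))) := by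
      refine (h.mul (IsCliqueProd.prod ((P ∪ (τ ∩ A)) ∩ A).toFinite.toFinset
        fun v _ => hind v)).congr fun x => ?_
      by_cases hx : ∀ v ∈ (P ∪ (τ ∩ A)) ∩ A, x v = a0 v
      · rw [hcons.condM_eq hSA hx, union_inter_diff, Finset.prod_eq_one, mul_one]
        intro v hv
        exact if_pos (hx v ((Set.Finite.mem_toFinset _).1 hv))
      · push Not at hx
        obtain ⟨v, hv, hxv⟩ := hx
        rw [hcons.condM_eq_zero hv hxv,
          Finset.prod_eq_zero ((Set.Finite.mem_toFinset _).2 hv) (if_neg hxv), mul_zero]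
    obtain ⟨ψ, hψ, hc⟩ := hc
    refine ⟨ψ, hψ, fun x => ?_⟩
    simp only [← hc]
    by_cases h0 : marginal f (P ∪ (τ ∩ A)) x = 0
    · rw [condM_of_eq_zero h0, zero_div]
    · change _ = _ / sumOver (τ \ A) (condM f (τ \ A) (P ∪ (τ ∩ A))) x
      rw [hf.sumOver_condM _ h0, div_one]
      rw [Set.disjoint_union_right]
      exact ⟨hPτ.symm.mono_left Set.sdiff_subset, hSA.mono_right Set.inter_subset_right⟩

lemma NoReturn.factorizesCGInt_iff {E : Set (V × V)} (hE : NoReturn E) (hf : IsPMF f)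
    (hcons : ConsistentWith f A a0) :
    FactorizesCGInt E A f ↔
      (∀ x, f x = ∏ τ ∈ comps E, condM f (τ \ A) (gPaTau E τ ∪ (τ ∩ A)) x) ∧
      ∀ τ ∈ gComps E, IsCliqueProd (moral (gInduced E (τ ∪ gPaTau E τ)))
        (condM f (τ \ A) (gPaTau E τ \ A)) := by
  refine and_congr (forall_congr' fun x => ?_)
    (forall₂_congr fun τ hτ => hE.clique_factorization_iff hf hcons hτ)
  rw [finprod_mem_eq_finite_toFinset_prod _ (Set.toFinite _), comps]

end Intervention

end BH

namespace BH

section Refinement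

variable {V : Type*} {E : Set (V × V)} {A σ τ : Set V}

lemma subset_of_mem_of_mem (hτ : τ ∈ gComps E) (hσ : σ ∈ gComps (removeVertices E A)) {v : V}
    (hvσ : v ∈ σ) (hvτ : v ∈ τ) : σ ⊆ τ := by
  rw [eq_gComp_of_mem hσ hvσ, eq_gComp_of_mem hτ hvτ]
  exact gComp_removeVertices_subset E A v

lemma disjoint_or_eq_singleton (hσ : σ ∈ gComps (removeVertices E A)) :
    Disjoint σ A ∨ ∃ a ∈ A, σ = {a} := by
  by_cases h : Disjoint σ A
  · exact Or.inl h
  · obtain ⟨a, ha, haA⟩ := Set.not_disjoint_iff.1 h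
    exact Or.inr ⟨a, haA, eq_singleton_of_mem_gComps_removeVertices hσ ha haA⟩

lemma gPaTau_removeVertices_singleton {a : V} (ha : a ∈ A) :
    gPaTau (removeVertices E A) {a} = ∅ := by
  ext u
  simp only [gPaTau, gPaSet, Set.mem_singleton_iff, Set.iUnion_iUnion_eq_left, Set.mem_sdiff,
    Set.mem_ofPred_eq, gPar_removeVertices, Set.mem_empty_iff_false]
  tauto

/-- Vertices that reach each other lie in the same chain component. -/
lemma NoReturn.mem_gComp_of_reach (hE : NoReturn E) {t v : V}
    (htv : Relation.ReflTransGen (fun a b => (a, b) ∈ E) t v)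
    (hvt : Relation.ReflTransGen (fun a b => (a, b) ∈ E) v t) : v ∈ gComp E t := by
  induction htv with
  | refl => exact mem_gComp_self E t
  | @tail b c htb hbc ih =>
    have hcb : (c, b) ∈ E := by
      by_contra h
      exact hE b c ⟨hbc, h⟩ (hvt.trans htb)
    exact Relation.ReflTransGen.tail (ih (hvt.head hbc)) ⟨hbc, hcb⟩

lemma NoReturn.gPaTau_removeVertices_subset (hE : NoReturn E) (hτ : τ ∈ gComps E)
    (hσ : σ ∈ gComps (BH.removeVertices E A)) (hστ : σ ⊆ τ) :
    gPaTau (BH.removeVertices E A) σ ⊆ gPaTau E τ \ A := by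
  intro u hu
  obtain ⟨v, hv, huv⟩ := ((hE.removeVertices A).mem_gPaTau hσ).1 hu
  rw [gPar_removeVertices] at huv
  exact ⟨(hE.mem_gPaTau hτ).2 ⟨v, hστ hv, huv.1⟩, huv.2.1⟩

lemma NoReturn.gPaTau_removeVertices_diff (hE : NoReturn E)
    (hσ : σ ∈ gComps (BH.removeVertices E A)) :
    gPaTau (BH.removeVertices E A) σ \ A = gPaTau (BH.removeVertices E A) σ := by
  refine Set.sdiff_subset.antisymm fun u hu => ⟨hu, ?_⟩
  obtain ⟨v, -, huv⟩ := ((hE.removeVertices A).mem_gPaTau hσ).1 hu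
  exact (gPar_removeVertices.1 huv).2.1

/-- A clique of the moral graph of a component that meets a refined component outside `A`
lies, outside `A`, in the closure of the refined component. -/
lemma NoReturn.clique_subset (hE : NoReturn E) (hτ : τ ∈ gComps E)
    (hσ : σ ∈ gComps (BH.removeVertices E A)) (hστ : σ ⊆ τ) {K : Set V}
    (hK : IsCliqueIn (moral (gInduced E (τ ∪ gPaTau E τ))) K) {v : V} (hvK : v ∈ K)
    (hvσ : v ∈ σ) (hvA : v ∉ A) {u : V} (hu : u ∈ K) (huA : u ∉ A) :
    u ∈ σ ∨ u ∈ gPaTau (BH.removeVertices E A) σ ∧ u ∈ gPaTau E τ := by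
  by_cases huv : u = v
  · exact Or.inl (huv ▸ hvσ)
  have hvτ := hστ hvσ
  rcases (hE.mem_moral_gInduced hτ huv).1 (hK u hu v hvK huv) with h | ⟨hadj, huτ | huP, -⟩
  · exact absurd hvτ h.2.2
  · have h : gNbr E u v := hadj.elim (hE.gNbr_of_mem hτ huτ hvτ)
      fun h => gNbr_symm (hE.gNbr_of_mem hτ hvτ huτ h)
    exact Or.inl (mem_of_gNbr hσ hvσ (gNbr_removeVertices.2 ⟨gNbr_symm h, hvA, huA⟩))
  · obtain ⟨w, hw, huw⟩ := (hE.mem_gPaTau hτ).1 huP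
    have hvu : (v, u) ∉ E := fun h => hE u w huw ((reach_of_mem hτ hw hvτ).tail h)
    exact Or.inr ⟨((hE.removeVertices A).mem_gPaTau hσ).2
      ⟨v, hvσ, gPar_removeVertices.2 ⟨⟨hadj.resolve_right hvu, hvu⟩, huA, hvA⟩⟩, huP⟩

lemma NoReturn.isCliqueIn_diff (hE : NoReturn E) (hτ : τ ∈ gComps E)
    (hσ : σ ∈ gComps (BH.removeVertices E A)) (hστ : σ ⊆ τ) {K : Set V}
    (hK : IsCliqueIn (moral (gInduced E (τ ∪ gPaTau E τ))) K)
    (hKσ : (K ∩ (σ \ A)).Nonempty) :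
    IsCliqueIn (moral (gInduced (BH.removeVertices E A)
      (σ ∪ gPaTau (BH.removeVertices E A) σ))) (K ∩ Aᶜ) := by
  obtain ⟨v, hvK, hvσ, hvA⟩ := hKσ
  rintro u ⟨hu, huA⟩ w ⟨hw, hwA⟩ huw
  rw [(hE.removeVertices A).mem_moral_gInduced hσ huw]
  have hu' := hE.clique_subset hτ hσ hστ hK hvK hvσ hvA hu huA
  have hw' := hE.clique_subset hτ hσ hστ hK hvK hvσ hvA hw hwA
  rcases (hE.mem_moral_gInduced hτ huw).1 (hK u hu w hw huw) with h | ⟨hadj, -⟩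
  · exact Or.inl ⟨hu'.elim (fun h' => absurd (hστ h') h.1.2) And.left,
      hw'.elim (fun h' => absurd (hστ h') h.2.2) And.left⟩
  · exact Or.inr ⟨hadj.imp (fun h => ⟨h, huA, hwA⟩) (fun h => ⟨h, hwA, huA⟩),
      hu'.imp_right And.left, hw'.imp_right And.left⟩

/-- Cliques of the refined moral graph are cliques of the original one. -/
lemma NoReturn.isCliqueIn_of_removeVertices (hE : NoReturn E) (hτ : τ ∈ gComps E)
    (hσ : σ ∈ gComps (BH.removeVertices E A)) (hστ : σ ⊆ τ) {K : Set V}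
    (hK : IsCliqueIn (moral (gInduced (BH.removeVertices E A)
      (σ ∪ gPaTau (BH.removeVertices E A) σ))) K) :
    IsCliqueIn (moral (gInduced E (τ ∪ gPaTau E τ))) K := by
  intro u hu v hv huv
  have hP := hE.gPaTau_removeVertices_subset hτ hσ hστ
  have hsub : σ ∪ gPaTau (BH.removeVertices E A) σ ⊆ τ ∪ gPaTau E τ :=
    Set.union_subset_union hστ (hP.trans Set.sdiff_subset)
  rw [hE.mem_moral_gInduced hτ huv]
  rcases ((hE.removeVertices A).mem_moral_gInduced hσ huv).1 (hK u hu v hv huv) with h | h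
  · exact Or.inl ⟨(hP h.1).1, (hP h.2).1⟩
  · exact Or.inr ⟨h.1.imp And.left And.left, hsub h.2.1, hsub h.2.2⟩

/-- The vertices reachable from a set. -/
def reachable (E : Set (V × V)) (τ : Set V) : Set V :=
  {w | ∃ v ∈ τ, Relation.ReflTransGen (fun a b => (a, b) ∈ E) v w}

lemma subset_reachable (E : Set (V × V)) (τ : Set V) : τ ⊆ reachable E τ :=
  fun v hv => ⟨v, hv, Relation.ReflTransGen.refl⟩

lemma mem_reachable {v w : V} (hv : v ∈ reachable E τ) (h : (v, w) ∈ E) :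
    w ∈ reachable E τ := by
  obtain ⟨t, ht, htv⟩ := hv
  exact ⟨t, ht, htv.tail h⟩

lemma NoReturn.gPaTau_subset_compl_reachable (hE : NoReturn E) (hτ : τ ∈ gComps E) :
    gPaTau E τ ⊆ (reachable E τ)ᶜ := by
  rintro u hu ⟨t, ht, htu⟩
  obtain ⟨v, hv, huv⟩ := (hE.mem_gPaTau hτ).1 hu
  exact hE u v huv ((reach_of_mem hτ hv ht).trans htu)

/-- Descendants of a component together with its intervened part stay closed under the edges
that remain after the intervention. -/
lemma NoReturn.reachable_diff_closed (hE : NoReturn E) (hτ : τ ∈ gComps E) {v w : V}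
    (hv : v ∈ reachable E τ \ (τ \ A)) (h : (v, w) ∈ BH.removeVertices E A) :
    w ∈ reachable E τ \ (τ \ A) := by
  obtain ⟨hE', hvA, -⟩ := h
  refine ⟨mem_reachable hv.1 hE', fun hw => hv.2 ⟨?_, hvA⟩⟩
  obtain ⟨t, ht, htv⟩ := hv.1
  rw [eq_gComp_of_mem hτ ht]
  exact hE.mem_gComp_of_reach htv ((reach_of_mem hτ hw.1 ht).head hE')

variable [Fintype V]

open Classical in
/-- The components of the graph after removing `A` that refine the component `τ`. -/
noncomputable def subcomps (E : Set (V × V)) (A τ : Set V) : Finset (Set V) :=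
  {σ ∈ comps (removeVertices E A) | σ ⊆ τ}

lemma mem_subcomps : σ ∈ subcomps E A τ ↔ σ ∈ gComps (removeVertices E A) ∧ σ ⊆ τ := by
  simp only [subcomps, Finset.mem_filter, mem_comps]

lemma prod_comps_removeVertices (E : Set (V × V)) (A : Set V) (F : Set V → ℝ) :
    ∏ σ ∈ comps (removeVertices E A), F σ = ∏ τ ∈ comps E, ∏ σ ∈ subcomps E A τ, F σ := by
  classical
  rw [← Finset.prod_biUnion]
  · refine Finset.prod_congr (Finset.ext fun σ => ?_) fun _ _ => rfl
    simp only [Finset.mem_biUnion, mem_subcomps, mem_comps]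
    refine ⟨fun hσ => ?_, fun ⟨_, _, h, _⟩ => h⟩
    obtain ⟨v, hv⟩ := gComps_nonempty hσ
    exact ⟨gComp E v, gComp_mem_gComps E v, hσ,
      subset_of_mem_of_mem (gComp_mem_gComps E v) hσ hv (mem_gComp_self E v)⟩
  · intro τ hτ τ' hτ' hne
    refine Finset.disjoint_left.2 fun σ hσ hσ' => ?_
    rw [mem_subcomps] at hσ hσ'
    obtain ⟨v, hv⟩ := gComps_nonempty hσ.1
    exact Set.disjoint_left.1 (gComps_pairwiseDisjoint (mem_comps.1 hτ) (mem_comps.1 hτ') hne)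
      (hσ.2 hv) (hσ'.2 hv)

lemma iUnion_subcomps_diff (hτ : τ ∈ gComps E) : ⋃ σ ∈ subcomps E A τ, σ \ A = τ \ A := by
  ext v
  simp only [Set.mem_iUnion, exists_prop, mem_subcomps, Set.mem_sdiff]
  constructor
  · rintro ⟨σ, ⟨-, hσ⟩, hv, hvA⟩
    exact ⟨hσ hv, hvA⟩
  · rintro ⟨hv, hvA⟩
    exact ⟨gComp (removeVertices E A) v, ⟨gComp_mem_gComps _ v,
      subset_of_mem_of_mem hτ (gComp_mem_gComps _ v) (mem_gComp_self _ v) hv⟩,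
      mem_gComp_self _ v, hvA⟩

lemma disjoint_of_mem_subcomps {σ' : Set V} (hσ : σ ∈ subcomps E A τ)
    (hσ' : σ' ∈ subcomps E A τ) (h : σ ≠ σ') : Disjoint σ σ' :=
  gComps_pairwiseDisjoint (mem_subcomps.1 hσ).1 (mem_subcomps.1 hσ').1 h

end Refinement

end BH

namespace BH

section RefinedFactors

variable {V : Type*} [Fintype V] {E : Set (V × V)} {A σ τ : Set V}

lemma NoReturn.disjoint_gPaTau_removeVertices (hE : NoReturn E) (hτ : τ ∈ gComps E)
    (hσ : σ ∈ subcomps E A τ) : Disjoint (gPaTau (BH.removeVertices E A) σ) τ :=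
  Set.disjoint_left.2 fun _ hu => (hE.gPaTau_removeVertices_subset hτ (mem_subcomps.1 hσ).1
    (mem_subcomps.1 hσ).2 hu).1.2

lemma NoReturn.closure_disjoint (hE : NoReturn E) (hτ : τ ∈ gComps E) {σ' : Set V}
    (hσ : σ ∈ subcomps E A τ) (hσ' : σ' ∈ subcomps E A τ) (h : σ ≠ σ') :
    Disjoint (σ \ A ∪ gPaTau (BH.removeVertices E A) σ) (σ' \ A) := by
  rw [Set.disjoint_union_left]
  exact ⟨(disjoint_of_mem_subcomps hσ hσ' h).mono Set.sdiff_subset Set.sdiff_subset,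
    (hE.disjoint_gPaTau_removeVertices hτ hσ).mono_right
      (Set.sdiff_subset.trans (mem_subcomps.1 hσ').2)⟩

variable [DecidableEq V] {X : V → Type*} [∀ v, Fintype (X v)] {f : (∀ v, X v) → ℝ}

/-- If the conditional pmf of a component is a product of normalized factors over the refined
components, then each factor is a conditional pmf. -/
lemma NoReturn.marginal_eq_mul_factor (hE : NoReturn E) (hτ : τ ∈ gComps E)
    {q : Set V → (∀ v, X v) → ℝ}
    (hq : ∀ σ ∈ subcomps E A τ, DependsOn (q σ) (σ \ A ∪ gPaTau (BH.removeVertices E A) σ))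
    (hq1 : ∀ x, marginal f (gPaTau E τ \ A) x ≠ 0 →
      ∀ σ ∈ subcomps E A τ, sumOver (σ \ A) (q σ) x = 1)
    (hprod : ∀ x, marginal f (τ \ A ∪ gPaTau E τ \ A) x =
      marginal f (gPaTau E τ \ A) x * ∏ σ ∈ subcomps E A τ, q σ x)
    (hσ : σ ∈ subcomps E A τ) (x : ∀ v, X v) :
    marginal f (σ \ A ∪ gPaTau (BH.removeVertices E A) σ) x =
      marginal f (gPaTau (BH.removeVertices E A) σ) x * q σ x := by
  classical
  set T := gPaTau E τ \ A with hT
  set R := gPaTau (BH.removeVertices E A) σ with hR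
  have hστ := (mem_subcomps.1 hσ).2
  have hRT : R ⊆ T := hE.gPaTau_removeVertices_subset hτ (mem_subcomps.1 hσ).1 hστ
  have hTτ : Disjoint T τ := Set.disjoint_left.2 fun u hu => hu.1.2
  have hTσ : Disjoint T (σ \ A) := hTτ.mono_right (Set.sdiff_subset.trans hστ)
  set B : Set V := ⋃ σ' ∈ (subcomps E A τ).erase σ, σ' \ A with hB
  have hBτ : B ⊆ τ \ A := by
    rw [← iUnion_subcomps_diff hτ]
    exact Set.biUnion_subset_biUnion_left fun _ h => Finset.mem_of_mem_erase h
  have hσB : Disjoint (σ \ A ∪ R) B := by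
    rw [hB, Set.disjoint_iUnion₂_right]
    exact fun σ' hσ' => hE.closure_disjoint hτ hσ (Finset.mem_of_mem_erase hσ')
      (Finset.ne_of_mem_erase hσ').symm
  have hTB : Disjoint T B := hTτ.mono_right (hBτ.trans Set.sdiff_subset)
  have hBσ : (τ \ A) \ B = σ \ A := by
    have h : τ \ A = σ \ A ∪ B := by
      rw [← iUnion_subcomps_diff hτ, hB, ← Finset.set_biUnion_insert σ _ (fun σ' => σ' \ A),
        Finset.insert_erase hσ]
    rw [h, Set.union_sdiff_right, (hσB.mono_left Set.subset_union_left).sdiff_eq_left]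
  have h1 : ∀ x, marginal f (σ \ A ∪ T) x = marginal f T x * q σ x := fun x => by
    have h2 := sumOver_marginal f (hBτ.trans (Set.subset_union_left (t := T))) x
    rw [Set.union_sdiff_distrib, hBσ, hTB.sdiff_eq_left] at h2
    rw [← h2, funext hprod, sumOver_mul_left (marginal_dependsOn f T) hTB]
    by_cases h0 : marginal f T x = 0
    · rw [h0, zero_mul, zero_mul]
    · congr 1
      simp only [← Finset.mul_prod_erase _ _ hσ]
      rw [sumOver_mul_left (hq σ hσ) hσB, hB, sumOver_prod _ _ _ _
        (fun i hi => hq i (Finset.mem_of_mem_erase hi))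
        (fun i hi j hj => hE.closure_disjoint hτ (Finset.mem_of_mem_erase hi)
          (Finset.mem_of_mem_erase hj))
        (fun i hi j hj h => (hE.closure_disjoint hτ (Finset.mem_of_mem_erase hi)
          (Finset.mem_of_mem_erase hj) h).mono_left Set.subset_union_left),
        Finset.prod_eq_one, mul_one]
      exact fun i hi => hq1 x h0 i (Finset.mem_of_mem_erase hi)
  have hTR : Disjoint (σ \ A ∪ R) (T \ R) := by
    rw [Set.disjoint_union_left]
    exact ⟨hTσ.symm.mono_right Set.sdiff_subset, Set.disjoint_sdiff_right⟩
  have h3 := sumOver_marginal f (Set.sdiff_subset.trans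
    (Set.subset_union_right (s := σ \ A)) : T \ R ⊆ σ \ A ∪ T) x
  rw [Set.union_sdiff_distrib, (hTσ.symm.mono_right Set.sdiff_subset).sdiff_eq_left,
    Set.sdiff_sdiff_cancel_left hRT] at h3
  rw [← h3, funext h1]
  simp only [mul_comm _ (q σ _)]
  rw [sumOver_mul_left (hq σ hσ) hTR, sumOver_marginal f Set.sdiff_subset,
    Set.sdiff_sdiff_cancel_left hRT]

/-- A clique factorization of the conditional pmf of a component splits into normalized clique
factorizations over the refined components. -/
lemma NoReturn.exists_factors (hE : NoReturn E) (hτ : τ ∈ gComps E) (hf : IsPMF f)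
    (a0 : ∀ v, X v) (h : IsCliqueProd (moral (gInduced E (τ ∪ gPaTau E τ)))
      (condM f (τ \ A) (gPaTau E τ \ A))) :
    ∃ q : Set V → (∀ v, X v) → ℝ, (∀ σ ∈ subcomps E A τ,
        DependsOn (q σ) (σ \ A ∪ gPaTau (BH.removeVertices E A) σ) ∧
        IsCliqueProd (moral (gInduced (BH.removeVertices E A)
          (σ ∪ gPaTau (BH.removeVertices E A) σ))) (q σ)) ∧
      ∀ x, marginal f (gPaTau E τ \ A) x ≠ 0 →
        condM f (τ \ A) (gPaTau E τ \ A) x = ∏ σ ∈ subcomps E A τ, q σ x ∧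
        ∀ σ ∈ subcomps E A τ, sumOver (σ \ A) (q σ) x = 1 := by
  classical
  obtain ⟨v₀, -⟩ := gComps_nonempty hτ
  have : Nonempty V := ⟨v₀⟩
  set U := moral (gInduced E (τ ∪ gPaTau E τ)) with hU
  set T := gPaTau E τ \ A with hT
  have hTτ : Disjoint T τ := Set.disjoint_left.2 fun u hu => hu.1.2
  obtain ⟨ψ, hψ, hF⟩ := h
  let χ : Set V → (∀ v, X v) → ℝ := fun K x => ψ K (overwrite Aᶜ a0 x)
  let M : Finset (Set V) := (maxCliques U).toFinite.toFinset
  have hM : ∀ K ∈ M, K ∈ maxCliques U := fun K hK => (Set.Finite.mem_toFinset _).1 hK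
  have hχ0 : ∀ K ∈ M, ∀ x, 0 ≤ χ K x := fun K hK x => (hψ K (hM K hK)).1 _
  have hχ : ∀ K ∈ M, DependsOn (χ K) (K ∩ Aᶜ) := fun K hK =>
    (hψ K (hM K hK)).2.comp_overwrite _ _
  have hcl : ∀ K ∈ M, IsCliqueIn U K := fun K hK => (hM K hK).2.2.1
  let N : Set V → Finset (Set V) := fun σ => {K ∈ M | (K ∩ (σ \ A)).Nonempty}
  have hN : ∀ {σ K}, K ∈ N σ ↔ K ∈ M ∧ (K ∩ (σ \ A)).Nonempty := Finset.mem_filter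
  have hsub : ∀ σ ∈ subcomps E A τ, ∀ K ∈ N σ,
      K ∩ Aᶜ ⊆ σ \ A ∪ gPaTau (BH.removeVertices E A) σ := by
    rintro σ hσ K hK u ⟨hu, huA⟩
    obtain ⟨hKM, v, hvK, hvσ, hvA⟩ := hN.1 hK
    exact (hE.clique_subset hτ (mem_subcomps.1 hσ).1 (mem_subcomps.1 hσ).2 (hcl K hKM) hvK hvσ
      hvA hu huA).imp (fun h => ⟨h, huA⟩) And.left
  let Φ : Set V → (∀ v, X v) → ℝ := fun σ x => ∏ K ∈ N σ, χ K x
  have hΦ0 : ∀ σ x, 0 ≤ Φ σ x := fun σ x =>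
    Finset.prod_nonneg fun K hK => hχ0 K (hN.1 hK).1 x
  have hΦ : ∀ σ ∈ subcomps E A τ,
      DependsOn (Φ σ) (σ \ A ∪ gPaTau (BH.removeVertices E A) σ) := fun σ hσ =>
    DependsOn.prod fun K hK => (hχ K (hN.1 hK).1).mono (hsub σ hσ K hK)
  let Z : Set V → (∀ v, X v) → ℝ := fun σ => sumOver (σ \ A) (Φ σ)
  have hpa : ∀ σ ∈ subcomps E A τ, Disjoint (gPaTau (BH.removeVertices E A) σ) (σ \ A) :=
    fun σ hσ => (hE.disjoint_gPaTau_removeVertices hτ hσ).mono_right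
      (Set.sdiff_subset.trans (mem_subcomps.1 hσ).2)
  have hZ : ∀ σ ∈ subcomps E A τ,
      DependsOn (fun x => (Z σ x)⁻¹) (gPaTau (BH.removeVertices E A) σ) := by
    intro σ hσ x y hxy
    refine congrArg Inv.inv ((hΦ σ hσ).sumOver (σ \ A) x y fun v hv => hxy v ?_)
    exact hv.1.resolve_left hv.2
  let g : (∀ v, X v) → ℝ := fun x => ∏ K ∈ M with ¬ (K ∩ (τ \ A)).Nonempty, χ K x
  have hg : DependsOn g (τ \ A)ᶜ := DependsOn.prod fun K hK => by
    obtain ⟨hK, hne⟩ := Finset.mem_filter.1 hK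
    exact (hχ K hK).mono fun u hu huτ => hne ⟨u, hu.1, huτ⟩
  have hcond : ∀ x, condM f (τ \ A) T x = g x * ∏ σ ∈ subcomps E A τ, Φ σ x := by
    intro x
    have hover := (condM_dependsOn f (τ \ A) T).apply_overwrite (W := Aᶜ)
      (Set.union_subset (fun _ h => h.2) fun _ h => h.2) a0 x
    rw [← hover, hF, finprod_mem_eq_finite_toFinset_prod _ (Set.toFinite _)]
    change ∏ K ∈ M, χ K x = _
    rw [← Finset.prod_filter_mul_prod_filter_not M (fun K => (K ∩ (τ \ A)).Nonempty), mul_comm]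
    congr 1
    rw [← Finset.prod_biUnion]
    · refine Finset.prod_congr (Finset.ext fun K => ?_) fun _ _ => rfl
      simp only [Finset.mem_biUnion, Finset.mem_filter, hN]
      rw [← iUnion_subcomps_diff hτ, Set.inter_iUnion₂]
      simp only [Set.nonempty_iUnion, exists_prop]
      exact ⟨fun ⟨hK, σ, hσ, hne⟩ => ⟨σ, hσ, hK, hne⟩, fun ⟨σ, hσ, hK, hne⟩ => ⟨hK, σ, hσ, hne⟩⟩
    · intro σ hσ σ' hσ' hne
      refine Finset.disjoint_left.2 fun K hK hK' => ?_
      obtain ⟨-, u, huK, huσ', huA⟩ := hN.1 hK'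
      exact Set.disjoint_left.1 (hE.closure_disjoint hτ hσ hσ' hne)
        (hsub σ hσ K hK ⟨huK, huA⟩) ⟨huσ', huA⟩
  refine ⟨fun σ x => (Z σ x)⁻¹ * Φ σ x, fun σ hσ => ⟨?_, ?_⟩, fun x hx => ?_⟩
  · exact ((hZ σ hσ).mono Set.subset_union_right).mul (hΦ σ hσ)
  · refine IsCliqueProd.mul (IsCliqueProd.of_clique
      ((hE.removeVertices A).isCliqueIn_gPaTau (mem_subcomps.1 hσ).1)
      (fun x => inv_nonneg.2 (sumOver_nonneg (hΦ0 σ) x)) (hZ σ hσ))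
      (IsCliqueProd.prod _ fun K hK => ?_)
    obtain ⟨hKM, hne⟩ := hN.1 hK
    exact IsCliqueProd.of_clique (hE.isCliqueIn_diff hτ (mem_subcomps.1 hσ).1
      (mem_subcomps.1 hσ).2 (hcl K hKM) hne) (hχ0 K hKM) (hχ K hKM)
  · have h1 : g x * ∏ σ ∈ subcomps E A τ, Z σ x = 1 := by
      rw [← hf.sumOver_condM (hTτ.symm.mono_left Set.sdiff_subset) hx, funext hcond,
        sumOver_mul_left hg disjoint_compl_left, ← iUnion_subcomps_diff hτ,
        sumOver_prod _ _ _ _ hΦ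
          (fun i hi j hj => hE.closure_disjoint hτ hi hj)
          (fun i hi j hj h =>
            (hE.closure_disjoint hτ hi hj h).mono_left Set.subset_union_left)]
    have hZ0 : ∏ σ ∈ subcomps E A τ, Z σ x ≠ 0 := right_ne_zero_of_mul_eq_one h1
    refine ⟨?_, fun σ hσ => ?_⟩
    · rw [hcond, Finset.prod_mul_distrib, Finset.prod_inv_distrib, eq_inv_of_mul_eq_one_left h1]
    · rw [sumOver_mul_left (hZ σ hσ) (hpa σ hσ)]
      exact inv_mul_cancel₀ (Finset.prod_ne_zero_iff.1 hZ0 σ hσ)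

end RefinedFactors

end BH

namespace BH

section Transfer

variable {V : Type*} [Fintype V] [DecidableEq V] {X : V → Type*} [∀ v, Fintype (X v)]
  {E : Set (V × V)} {A σ τ : Set V} {f : (∀ v, X v) → ℝ} {a0 : ∀ v, X v}

lemma NoReturn.condM_eq_factor (hE : NoReturn E) (hτ : τ ∈ gComps E)
    {q : Set V → (∀ v, X v) → ℝ}
    (hq : ∀ σ ∈ subcomps E A τ, DependsOn (q σ) (σ \ A ∪ gPaTau (BH.removeVertices E A) σ))
    (hq1 : ∀ x, marginal f (gPaTau E τ \ A) x ≠ 0 →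
      ∀ σ ∈ subcomps E A τ, sumOver (σ \ A) (q σ) x = 1)
    (hprod : ∀ x, marginal f (τ \ A ∪ gPaTau E τ \ A) x =
      marginal f (gPaTau E τ \ A) x * ∏ σ ∈ subcomps E A τ, q σ x)
    (hσ : σ ∈ subcomps E A τ) {x : ∀ v, X v}
    (hx : marginal f (gPaTau (BH.removeVertices E A) σ) x ≠ 0) :
    condM f (σ \ A) (gPaTau (BH.removeVertices E A) σ \ A) x = q σ x := by
  rw [hE.gPaTau_removeVertices_diff (mem_subcomps.1 hσ).1, condM,
    hE.marginal_eq_mul_factor hτ hq hq1 hprod hσ, mul_div_cancel_left₀ _ hx]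

/-- The conditional pmfs of the components split into those of the refined components. -/
def Splits (E : Set (V × V)) (A : Set V) (f : (∀ v, X v) → ℝ) : Prop :=
  ∀ τ ∈ gComps E, ∀ x, marginal f (gPaTau E τ \ A) x ≠ 0 →
    condM f (τ \ A) (gPaTau E τ \ A) x =
      ∏ σ ∈ subcomps E A τ, condM f (σ \ A) (gPaTau (removeVertices E A) σ \ A) x

lemma NoReturn.splits_of_isCliqueProd (hE : NoReturn E) (hf : IsPMF f) (a0 : ∀ v, X v)
    (h : ∀ τ ∈ gComps E, IsCliqueProd (moral (gInduced E (τ ∪ gPaTau E τ)))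
      (condM f (τ \ A) (gPaTau E τ \ A))) :
    Splits E A f ∧ ∀ σ ∈ gComps (BH.removeVertices E A),
      IsCliqueProd (moral (gInduced (BH.removeVertices E A)
        (σ ∪ gPaTau (BH.removeVertices E A) σ)))
        (condM f (σ \ A) (gPaTau (BH.removeVertices E A) σ \ A)) := by
  classical
  have key : ∀ τ ∈ gComps E, ∃ q : Set V → (∀ v, X v) → ℝ,
      (∀ σ ∈ subcomps E A τ, IsCliqueProd (moral (gInduced (BH.removeVertices E A)
          (σ ∪ gPaTau (BH.removeVertices E A) σ))) (q σ)) ∧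
      (∀ x, marginal f (gPaTau E τ \ A) x ≠ 0 →
        condM f (τ \ A) (gPaTau E τ \ A) x = ∏ σ ∈ subcomps E A τ, q σ x) ∧
      ∀ σ ∈ subcomps E A τ, ∀ x, marginal f (gPaTau (BH.removeVertices E A) σ) x ≠ 0 →
        condM f (σ \ A) (gPaTau (BH.removeVertices E A) σ \ A) x = q σ x := by
    intro τ hτ
    obtain ⟨q, hq, hqx⟩ := hE.exists_factors hτ hf a0 (h τ hτ)
    refine ⟨q, fun σ hσ => (hq σ hσ).2, fun x hx => (hqx x hx).1, fun σ hσ x hx =>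
      hE.condM_eq_factor hτ (fun σ hσ => (hq σ hσ).1) (fun x hx => (hqx x hx).2) ?_ hσ hx⟩
    intro x
    rw [← hf.condM_mul]
    by_cases h0 : marginal f (gPaTau E τ \ A) x = 0
    · rw [h0, zero_mul, zero_mul]
    · rw [(hqx x h0).1]
  refine ⟨fun τ hτ x hx => ?_, fun σ hσ => ?_⟩
  · obtain ⟨q, -, hqx, hc⟩ := key τ hτ
    rw [hqx x hx]
    refine Finset.prod_congr rfl fun σ hσ => (hc σ hσ x fun h0 => hx ?_).symm
    exact hf.marginal_eq_zero (hE.gPaTau_removeVertices_subset hτ (mem_subcomps.1 hσ).1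
      (mem_subcomps.1 hσ).2) h0
  · obtain ⟨v, hv⟩ := gComps_nonempty hσ
    have : Nonempty V := ⟨v⟩
    have hτ := gComp_mem_gComps E v
    have hσv : σ ∈ subcomps E A (gComp E v) :=
      mem_subcomps.2 ⟨hσ, subset_of_mem_of_mem hτ hσ hv (mem_gComp_self E v)⟩
    obtain ⟨q, hq, -, hc⟩ := key _ hτ
    refine ((IsCliqueProd.of_clique ((hE.removeVertices A).isCliqueIn_gPaTau hσ)
      (F := fun x => if marginal f (gPaTau (BH.removeVertices E A) σ) x = 0 then (0 : ℝ) else 1)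
      (fun x => by split_ifs <;> norm_num)
      (fun x y hxy => by simp only [marginal_dependsOn f _ x y hxy])).mul (hq σ hσv)).congr
      fun x => ?_
    by_cases h0 : marginal f (gPaTau (BH.removeVertices E A) σ) x = 0
    · rw [if_pos h0, zero_mul, hE.gPaTau_removeVertices_diff hσ, condM_of_eq_zero h0]
    · rw [if_neg h0, one_mul, hc σ hσv x h0]

lemma NoReturn.isCliqueProd_of_splits (hE : NoReturn E) (hs : Splits E A f)
    (h : ∀ σ ∈ gComps (BH.removeVertices E A),
      IsCliqueProd (moral (gInduced (BH.removeVertices E A)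
        (σ ∪ gPaTau (BH.removeVertices E A) σ)))
        (condM f (σ \ A) (gPaTau (BH.removeVertices E A) σ \ A)))
    (hτ : τ ∈ gComps E) : IsCliqueProd (moral (gInduced E (τ ∪ gPaTau E τ)))
      (condM f (τ \ A) (gPaTau E τ \ A)) := by
  classical
  obtain ⟨v, -⟩ := gComps_nonempty hτ
  have : Nonempty V := ⟨v⟩
  refine ((IsCliqueProd.of_clique ((hE.isCliqueIn_gPaTau hτ).mono (Set.sdiff_subset (t := A)))
    (F := fun x => if marginal f (gPaTau E τ \ A) x = 0 then (0 : ℝ) else 1)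
    (fun x => by split_ifs <;> norm_num)
    (fun x y hxy => by simp only [marginal_dependsOn f _ x y hxy])).mul
    (IsCliqueProd.prod (subcomps E A τ) fun σ hσ => (h σ (mem_subcomps.1 hσ).1).mono fun K =>
      hE.isCliqueIn_of_removeVertices hτ (mem_subcomps.1 hσ).1 (mem_subcomps.1 hσ).2)).congr
    fun x => ?_
  by_cases h0 : marginal f (gPaTau E τ \ A) x = 0
  · rw [if_pos h0, zero_mul, condM_of_eq_zero h0]
  · rw [if_neg h0, one_mul, hs τ hτ x h0]

lemma IsPMF.marginal_ne_zero (hf : IsPMF f) {x : ∀ v, X v} (hx : f x ≠ 0) (S : Set V) :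
    marginal f S x ≠ 0 := fun h => hx <| by
  rw [← marginal_univ f x]
  exact hf.marginal_eq_zero (Set.subset_univ S) h

/-- On the support of `f`, both graphs have the same product of conditional pmfs. -/
lemma Splits.prod_eq (hs : Splits E A f) (hf : IsPMF f) (hcons : ConsistentWith f A a0)
    {x : ∀ v, X v} (hx : f x ≠ 0) :
    ∏ τ ∈ comps E, condM f (τ \ A) (gPaTau E τ ∪ (τ ∩ A)) x =
      ∏ σ ∈ comps (removeVertices E A),
        condM f (σ \ A) (gPaTau (removeVertices E A) σ ∪ (σ ∩ A)) x := by
  have h : ∀ P τ : Set V, condM f (τ \ A) (P ∪ (τ ∩ A)) x = condM f (τ \ A) (P \ A) x :=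
    fun P τ => by
      rw [hcons.condM_eq Set.disjoint_sdiff_left fun v hv => hcons x hx v hv.2, union_inter_diff]
  simp only [h]
  rw [prod_comps_removeVertices]
  exact Finset.prod_congr rfl fun τ hτ =>
    hs τ (mem_comps.1 hτ) x (hf.marginal_ne_zero hx _)

/-- The conditional pmfs of the refined components, given the intervention, are dominated by
normalized kernels. -/
lemma ConsistentWith.condM_le_fullCond_gPaTau (hcons : ConsistentWith f A a0)
    (hf : IsPMF f) (hσ : σ ∈ gComps (BH.removeVertices E A)) (x : ∀ v, X v) :
    condM f (σ \ A) (gPaTau (BH.removeVertices E A) σ ∪ (σ ∩ A)) x ≤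
      fullCond f σ (gPaTau (BH.removeVertices E A) σ) x := by
  rcases disjoint_or_eq_singleton hσ with h | ⟨a, ha, rfl⟩
  · rw [h.sdiff_eq_left, h.inter_eq, Set.union_empty]
    exact condM_le_fullCond f _ _ x
  · have hA : ({a} : Set V) ⊆ A := Set.singleton_subset_iff.2 ha
    have h0 : marginal f ∅ x = 1 := hf.marginal_empty x
    rw [gPaTau_removeVertices_singleton ha, Set.sdiff_eq_empty.2 hA, Set.inter_eq_left.2 hA,
      Set.empty_union, fullCond_of_ne (h0 ▸ one_ne_zero)]
    by_cases hx : x a = a0 a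
    · have h1 : marginal f {a} x = 1 := by
        rw [← h0, ← hcons.marginal_union hA (S := ∅) (by rintro v rfl; exact hx),
          Set.empty_union]
      simp only [condM, Set.empty_union, Set.union_empty, h0, h1, le_refl]
    · rw [hcons.condM_eq_zero (T := {a}) ⟨Set.mem_singleton a, ha⟩ hx]
      exact hf.condM_nonneg _ _ _

lemma ConsistentWith.prod_condM_le (hcons : ConsistentWith f A a0) (hf : IsPMF f) (x : ∀ v, X v) :
    ∏ σ ∈ comps (BH.removeVertices E A),
        condM f (σ \ A) (gPaTau (BH.removeVertices E A) σ ∪ (σ ∩ A)) x ≤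
      ∏ σ ∈ comps (BH.removeVertices E A), fullCond f σ (gPaTau (BH.removeVertices E A) σ) x :=
  Finset.prod_le_prod (fun _ _ => hf.condM_nonneg _ _ _) fun _ hσ =>
    hcons.condM_le_fullCond_gPaTau hf (mem_comps.1 hσ) x

lemma NoReturn.eq_prod_fullCond (hE : NoReturn E) (hf : IsPMF f)
    (hle : ∀ x, f x ≤ ∏ τ ∈ comps E, fullCond f τ (gPaTau E τ) x) (x : ∀ v, X v) :
    f x = ∏ τ ∈ comps E, fullCond f τ (gPaTau E τ) x :=
  hE.eq_prod_comps (k := fun τ => fullCond f τ (gPaTau E τ))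
    (fun _ _ => fullCond_dependsOn f _ _)
    (fun _ _ => hf.sumOver_fullCond (Set.disjoint_left.2 fun _ hu hu' => hu'.2 hu)) hf hle x

lemma NoReturn.factorizes_removeVertices (hE : NoReturn E) (hf : IsPMF f)
    (hcons : ConsistentWith f A a0) (h : FactorizesCGInt E A f) :
    FactorizesCGInt (BH.removeVertices E A) A f := by
  rw [hE.factorizesCGInt_iff hf hcons] at h
  rw [(hE.removeVertices A).factorizesCGInt_iff hf hcons]
  obtain ⟨hs, hcl⟩ := hE.splits_of_isCliqueProd hf a0 h.2
  refine ⟨fun x => ?_, hcl⟩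
  have hne : ∀ x, f x ≠ 0 → f x = ∏ σ ∈ comps (BH.removeVertices E A),
      condM f (σ \ A) (gPaTau (BH.removeVertices E A) σ ∪ (σ ∩ A)) x := fun x hx => by
    rw [← hs.prod_eq hf hcons hx, ← h.1 x]
  by_cases hx : f x = 0
  · have h0 : ∀ x, 0 ≤ ∏ σ ∈ comps (BH.removeVertices E A),
        condM f (σ \ A) (gPaTau (BH.removeVertices E A) σ ∪ (σ ∩ A)) x := fun x =>
      Finset.prod_nonneg fun _ _ => hf.condM_nonneg _ _ _
    have hk := (hE.removeVertices A).eq_prod_fullCond hf (fun y => by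
      refine le_trans ?_ (hcons.prod_condM_le hf y)
      by_cases hy : f y = 0
      · rw [hy]; exact h0 y
      · exact (hne y hy).le) x
    refine le_antisymm (hx ▸ h0 x) ?_
    rw [hk]
    exact hcons.prod_condM_le hf x
  · exact hne x hx

lemma NoReturn.splits_of_eq_prod (hE : NoReturn E) (hf : IsPMF f)
    (hk : ∀ x, f x = ∏ σ ∈ comps (BH.removeVertices E A),
      fullCond f σ (gPaTau (BH.removeVertices E A) σ) x) : Splits E A f := by
  classical
  intro τ hτ x hx
  set E' := BH.removeVertices E A with hE'
  set T := gPaTau E τ \ A with hT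
  have hTτ : Disjoint T τ := Set.disjoint_left.2 fun u hu => hu.1.2
  have hmarg : ∀ {D : Set V}, (∀ v ∈ D, ∀ w, (v, w) ∈ E' → w ∈ D) → ∀ x, marginal f Dᶜ x =
      ∏ σ ∈ comps E' with ¬ σ ⊆ D, fullCond f σ (gPaTau E' σ) x := fun hD =>
    (hE.removeVertices A).marginal_compl_eq_prod (k := fun σ => fullCond f σ (gPaTau E' σ))
      (fun _ _ => fullCond_dependsOn f _ _)
      (fun _ _ => hf.sumOver_fullCond (Set.disjoint_left.2 fun _ hu hu' => hu'.2 hu)) hk hD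
  set D := reachable E τ with hD
  have hDc : ∀ v ∈ D, ∀ w, (v, w) ∈ E' → w ∈ D := fun v hv w h => mem_reachable hv h.1
  have hDc' : ∀ v ∈ D \ (τ \ A), ∀ w, (v, w) ∈ E' → w ∈ D \ (τ \ A) := fun v hv w h =>
    hE.reachable_diff_closed hτ hv h
  have hτD : τ \ A ⊆ D := Set.sdiff_subset.trans (subset_reachable E τ)
  have hTD : T ⊆ Dᶜ := Set.sdiff_subset.trans (hE.gPaTau_subset_compl_reachable hτ)
  let Q : Finset (Set V) := {σ ∈ comps E' | σ ⊆ τ \ A}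
  have hQ : ∀ {σ}, σ ∈ Q ↔ σ ∈ gComps E' ∧ σ ⊆ τ \ A := by
    intro σ; simp only [Q, Finset.mem_filter, mem_comps]
  have hQs : ∀ σ ∈ Q, σ ∈ subcomps E A τ := fun σ hσ =>
    mem_subcomps.2 ⟨(hQ.1 hσ).1, (hQ.1 hσ).2.trans Set.sdiff_subset⟩
  have hQT : ∀ σ ∈ Q, gPaTau E' σ ⊆ T := fun σ hσ =>
    hE.gPaTau_removeVertices_subset hτ (hQ.1 hσ).1 (mem_subcomps.1 (hQs σ hσ)).2
  have h1 : ∀ x, marginal f (D \ (τ \ A))ᶜ x =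
      (∏ σ ∈ Q, fullCond f σ (gPaTau E' σ) x) * marginal f Dᶜ x := fun x => by
    rw [hmarg hDc', hmarg hDc, ← Finset.prod_union]
    · refine Finset.prod_congr (Finset.ext fun σ => ?_) fun _ _ => rfl
      simp only [Finset.mem_union, hQ, Finset.mem_filter, mem_comps]
      constructor
      · rintro ⟨hσ, hn⟩
        by_cases hσD : σ ⊆ D
        · refine Or.inl ⟨hσ, fun v hv => ?_⟩
          by_contra hvτ
          exact Set.disjoint_left.1 (disjoint_of_not_subset_closed hDc' hσ hn) hv ⟨hσD hv, hvτ⟩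
        · exact Or.inr ⟨hσ, hσD⟩
      · rintro (⟨hσ, hn⟩ | ⟨hσ, hn⟩)
        · obtain ⟨v, hv⟩ := gComps_nonempty hσ
          exact ⟨hσ, fun h => (h hv).2 (hn hv)⟩
        · exact ⟨hσ, fun h => hn (h.trans Set.sdiff_subset)⟩
    · exact Finset.disjoint_left.2 fun σ hσ hσ' =>
        (Finset.mem_filter.1 hσ').2 ((hQ.1 hσ).2.trans hτD)
  set R := Dᶜ \ T with hR
  have hRτ : Disjoint (τ \ A) R :=
    Set.disjoint_left.2 fun v hv hvR => hvR.1 (hτD hv)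
  have hcompl : (D \ (τ \ A))ᶜ = τ \ A ∪ Dᶜ := by
    rw [Set.sdiff_eq, Set.compl_inter, compl_compl, Set.union_comm]
  have h2 := sumOver_marginal f (hcompl ▸ Set.sdiff_subset.trans Set.subset_union_right :
    R ⊆ (D \ (τ \ A))ᶜ) x
  rw [funext h1, sumOver_mul_left (S := τ \ A ∪ T) (DependsOn.prod fun σ hσ =>
      (fullCond_dependsOn f _ _).mono (Set.union_subset_union (hQ.1 hσ).2 (hQT σ hσ)))
      (Set.disjoint_union_left.2 ⟨hRτ, Set.disjoint_sdiff_right⟩),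
    sumOver_marginal f Set.sdiff_subset, hcompl, Set.union_sdiff_distrib, hRτ.sdiff_eq_left,
    Set.sdiff_sdiff_cancel_left hTD] at h2
  rw [condM, ← h2, mul_div_cancel_right₀ _ hx]
  have hxσ : ∀ σ ∈ subcomps E A τ, marginal f (gPaTau E' σ) x ≠ 0 := fun σ hσ h0 =>
    hx (hf.marginal_eq_zero (hE.gPaTau_removeVertices_subset hτ (mem_subcomps.1 hσ).1
      (mem_subcomps.1 hσ).2) h0)
  rw [← Finset.prod_subset hQs]
  · refine Finset.prod_congr rfl fun σ hσ => ?_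
    rw [fullCond_of_ne (hxσ σ (hQs σ hσ)), hE.gPaTau_removeVertices_diff (hQ.1 hσ).1,
      sdiff_eq_left.2 (Set.disjoint_left.2 fun v hv => ((hQ.1 hσ).2 hv).2)]
  · intro σ hσ hσQ
    rcases disjoint_or_eq_singleton (mem_subcomps.1 hσ).1 with h | ⟨a, ha, rfl⟩
    · exact absurd (hQ.2 ⟨(mem_subcomps.1 hσ).1,
        Set.subset_sdiff.2 ⟨(mem_subcomps.1 hσ).2, h⟩⟩) hσQ
    · rw [Set.sdiff_eq_empty.2 (Set.singleton_subset_iff.2 ha)]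
      refine condM_empty ?_
      rw [hE.gPaTau_removeVertices_diff (mem_subcomps.1 hσ).1]
      exact hxσ _ hσ

lemma NoReturn.factorizes_of_removeVertices (hE : NoReturn E) (hf : IsPMF f)
    (hcons : ConsistentWith f A a0) (h : FactorizesCGInt (BH.removeVertices E A) A f) :
    FactorizesCGInt E A f := by
  rw [(hE.removeVertices A).factorizesCGInt_iff hf hcons] at h
  rw [hE.factorizesCGInt_iff hf hcons]
  have hs : Splits E A f := hE.splits_of_eq_prod hf
    ((hE.removeVertices A).eq_prod_fullCond hf fun x =>
      (h.1 x).le.trans (hcons.prod_condM_le hf x))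
  refine ⟨fun x => ?_, fun τ hτ => hE.isCliqueProd_of_splits hs h.2 hτ⟩
  by_cases hx : f x = 0
  · have hx' := hx
    rw [h.1 x, Finset.prod_eq_zero_iff] at hx'
    obtain ⟨σ, hσ, h0⟩ := hx'
    rw [mem_comps] at hσ
    obtain ⟨v, hv⟩ := gComps_nonempty hσ
    have hτ := gComp_mem_gComps E v
    have hστ := subset_of_mem_of_mem hτ hσ hv (mem_gComp_self E v)
    rw [hx, Finset.prod_eq_zero (mem_comps.2 hτ)]
    have hm := hf.condM_mul (σ \ A) (gPaTau (BH.removeVertices E A) σ ∪ (σ ∩ A)) x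
    rw [h0, mul_zero] at hm
    rw [condM, hf.marginal_eq_zero _ hm.symm, zero_div]
    exact Set.union_subset_union (Set.sdiff_subset_sdiff_left hστ) (Set.union_subset_union
      ((hE.gPaTau_removeVertices_subset hτ hσ hστ).trans Set.sdiff_subset)
      (Set.inter_subset_inter_left A hστ))
  · rw [hs.prod_eq hf hcons hx, ← h.1 x]

end Transfer

end BH

/-- If two chain graphs on the same vertex set become the same chain
graph after removing the intervened vertices `A` and all edges incident to them, then
they admit the same factorization decomposition: a pmf supported on configurations
consistent with `x_A = a₀` factorizes according to `(G₁, A)` iff it factorizes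
according to `(G₂, A)`. -/
theorem statement16 {V : Type*} [Fintype V] [DecidableEq V]
    {X : V → Type*} [∀ v, Fintype (X v)]
    (E₁ E₂ : Set (V × V)) (h₁ : BH.IsChainGraph E₁) (h₂ : BH.IsChainGraph E₂)
    (A : Set V) (a0 : ∀ v, X v)
    (hrem : BH.removeVertices E₁ A = BH.removeVertices E₂ A)
    (f : (∀ v, X v) → ℝ) (hf : BH.IsPMF f) (hcons : BH.ConsistentWith f A a0) :
    BH.FactorizesCGInt E₁ A f ↔ BH.FactorizesCGInt E₂ A f := by
  have key : ∀ E, BH.NoReturn E →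
      (BH.FactorizesCGInt E A f ↔ BH.FactorizesCGInt (BH.removeVertices E A) A f) :=
    fun E hE => ⟨hE.factorizes_removeVertices hf hcons, hE.factorizes_of_removeVertices hf hcons⟩
  rw [key E₁ h₁.noReturn, key E₂ h₂.noReturn, hrem]
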